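/- arXiv:1010.4220 — 2 statements merged into one kernel-verified Lean document; each statement's English description precedes it below -/
import Mathlib

section
/- If w ∈ F is unimodular and k ≥ 2, then every finite subgroup of G̃ is conjugate in G̃ either to a subgroup of ι̃(G) or to a subgroup of the cyclic subgroup ⟨q(w)⟩ generated by the image of w; that is, for every finite subgroup H ≤ G̃ there exists x ∈ G̃ with x H x⁻¹ contained in the image of ι̃ or x H x⁻¹ contained in the cyclic subgroup generated by q(w). -/
/-- `F = G ∗ ⟨t⟩`: the free product of `G` with an infinite cyclic group. -/
abbrev FP (G : Type*) [Group G] : Type _ := Monoid.Coprod G (FreeGroup Unit)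

/-- The additional generator `t ∈ F`. -/
def tgen (G : Type*) [Group G] : FP G := Monoid.Coprod.inr (FreeGroup.of ())

/-- The canonical embedding `ι : G → F`. -/
def emb (G : Type*) [Group G] : G →* FP G := Monoid.Coprod.inl

/-- The exponent-sum homomorphism `σ : F → ℤ` killing `G` and sending `t` to `1`. -/
def expSum (G : Type*) [Group G] : FP G →* Multiplicative ℤ :=
  Monoid.Coprod.lift 1 (FreeGroup.lift fun _ => Multiplicative.ofAdd (1 : ℤ))

/-- A word `w ∈ F` is unimodular if the exponent sum of `t` in `w` is `1`. -/
def Unimodular {G : Type*} [Group G] (w : FP G) : Prop :=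
  expSum G w = Multiplicative.ofAdd (1 : ℤ)

namespace Amalgam

variable {Γ ι : Type*} [Group Γ] (X : ι → Subgroup Γ) (B : Subgroup Γ)

/-- A list of syllables is reduced if each syllable lies in its factor but not in the base, and
consecutive syllables lie in different factors. -/
def IsReduced (l : List (ι × Γ)) : Prop :=
  (∀ p ∈ l, p.2 ∈ X p.1 ∧ p.2 ∉ B) ∧ l.IsChain fun p q => p.1 ≠ q.1

/-- The product of the syllables of a list. -/
def val (l : List (ι × Γ)) : Γ := (l.map Prod.snd).prod

/-- The list of inverse syllables in the opposite order. -/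
def inv (l : List (ι × Γ)) : List (ι × Γ) := (l.map fun p => (p.1, p.2⁻¹)).reverse

@[simp] theorem val_nil : val ([] : List (ι × Γ)) = 1 := rfl

@[simp] theorem val_cons (p : ι × Γ) (l : List (ι × Γ)) : val (p :: l) = p.2 * val l := by
  simp [val]

@[simp] theorem val_append (l l' : List (ι × Γ)) : val (l ++ l') = val l * val l' := by
  simp [val]

@[simp] theorem inv_cons (p : ι × Γ) (l : List (ι × Γ)) :
    inv (p :: l) = inv l ++ [(p.1, p.2⁻¹)] := by
  simp [inv]

@[simp] theorem val_inv (l : List (ι × Γ)) : val (inv l) = (val l)⁻¹ := by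
  induction l with
  | nil => simp [inv]
  | cons p l ih => simp [ih]

@[simp] theorem length_inv (l : List (ι × Γ)) : (inv l).length = l.length := by simp [inv]

variable {X B}

theorem isReduced_nil : IsReduced X B [] := by simp [IsReduced]

theorem IsReduced.inv {l : List (ι × Γ)} (h : IsReduced X B l) : IsReduced X B (inv l) := by
  refine ⟨?_, ?_⟩
  · intro p hp
    simp only [Amalgam.inv, List.mem_reverse, List.mem_map] at hp
    obtain ⟨q, hq, rfl⟩ := hp
    simpa using h.1 q hq
  · rw [Amalgam.inv, List.isChain_reverse, List.isChain_map]
    exact h.2.imp fun a b hab => hab.symm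

theorem isReduced_cons {p : ι × Γ} {l : List (ι × Γ)} :
    IsReduced X B (p :: l) ↔
      (p.2 ∈ X p.1 ∧ p.2 ∉ B) ∧ IsReduced X B l ∧ ∀ q ∈ l.head?, p.1 ≠ q.1 := by
  simp only [IsReduced, List.forall_mem_cons, List.isChain_cons]
  tauto

theorem isReduced_append {l l' : List (ι × Γ)} :
    IsReduced X B (l ++ l') ↔ IsReduced X B l ∧ IsReduced X B l' ∧
      ∀ p ∈ l.getLast?, ∀ q ∈ l'.head?, p.1 ≠ q.1 := by
  simp only [IsReduced, List.forall_mem_append, List.isChain_append]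
  tauto

theorem IsReduced.replace_head {p : ι × Γ} {l : List (ι × Γ)} (h : IsReduced X B (p :: l))
    {y : Γ} (hy : y ∈ X p.1) (hyB : y ∉ B) : IsReduced X B ((p.1, y) :: l) := by
  rw [isReduced_cons] at h ⊢
  exact ⟨⟨hy, hyB⟩, h.2⟩

theorem IsReduced.mul_head (hBX : ∀ i, B ≤ X i) {p : ι × Γ} {l : List (ι × Γ)}
    (h : IsReduced X B (p :: l)) {b : Γ} (hb : b ∈ B) :
    IsReduced X B ((p.1, b * p.2) :: l) := by
  have hp := (isReduced_cons.1 h).1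
  refine h.replace_head (mul_mem (hBX _ hb) hp.1) fun hB => hp.2 ?_
  rwa [Subgroup.mul_mem_cancel_left _ hb] at hB

theorem IsReduced.inv_append_of_ne {p p' : ι × Γ} {l l' : List (ι × Γ)}
    (h : IsReduced X B (p :: l)) (h' : IsReduced X B (p' :: l')) (hne : p.1 ≠ p'.1) :
    IsReduced X B (Amalgam.inv (p :: l) ++ p' :: l') := by
  rw [isReduced_append]
  refine ⟨h.inv, h', ?_⟩
  simpa using hne

theorem IsReduced.inv_append_of_eq {p p' : ι × Γ} {l l' : List (ι × Γ)}
    (h : IsReduced X B (p :: l)) (h' : IsReduced X B (p' :: l')) (heq : p.1 = p'.1)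
    (hB : p.2⁻¹ * p'.2 ∉ B) :
    IsReduced X B (Amalgam.inv l ++ (p'.1, p.2⁻¹ * p'.2) :: l') := by
  have hp := (isReduced_cons.1 h).1
  have hp' := (isReduced_cons.1 h').1
  rw [isReduced_append]
  refine ⟨(isReduced_cons.1 h).2.1.inv,
    h'.replace_head (mul_mem (inv_mem (heq ▸ hp.1)) hp'.1) hB, ?_⟩
  have := (isReduced_cons.1 h).2.2
  simp only [Amalgam.inv, List.getLast?_reverse, List.head?_map, Option.mem_def,
    Option.map_eq_some_iff, List.head?_cons, Option.some.injEq] at this ⊢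
  rintro _ ⟨q, hq, rfl⟩ _ rfl
  simpa [heq] using (this q hq).symm

variable (X B) in
/-- `HasLen X B g n` says that up to the base, `g` is a reduced product of `n` syllables. -/
def HasLen (g : Γ) (n : ℕ) : Prop :=
  ∃ l, IsReduced X B l ∧ l.length = n ∧ ∃ b ∈ B, val l = b * g

variable (X B) in
/-- The internal form of the normal form theorem for amalgamated products. -/
structure IsAmalgam : Prop where
  base_le : ∀ i, B ≤ X i
  exists_hasLen : ∀ g, ∃ n, HasLen X B g n
  eq_nil : ∀ l, IsReduced X B l → val l ∈ B → l = []

namespace IsAmalgam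

theorem length_eq (hA : IsAmalgam X B) {l l' : List (ι × Γ)} {b : Γ}
    (h : IsReduced X B l) (h' : IsReduced X B l')
    (hb : b ∈ B) (hv : val l = b * val l') : l.length = l'.length := by
  induction l generalizing l' b with
  | nil =>
    rw [hA.eq_nil l' h' ((Subgroup.mul_mem_cancel_left _ hb).1 (hv ▸ one_mem B))]
  | cons p l ih =>
    cases l' with
    | nil =>
      have := hA.eq_nil _ h (by rw [hv]; simpa using hb)
      simp at this
    | cons p' l' =>
      have h'' := h'.mul_head hA.base_le hb
      have hv' : val ((p'.1, b * p'.2) :: l') = val (p :: l) := by simp [hv, mul_assoc]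
      have heq : p.1 = p'.1 := by
        by_contra hne
        have := hA.eq_nil _ (h.inv_append_of_ne h'' hne)
          (by rw [val_append, val_inv, hv', inv_mul_cancel]; exact one_mem B)
        simp at this
      have hB : p.2⁻¹ * (b * p'.2) ∈ B := by
        by_contra hB
        have := hA.eq_nil _ (h.inv_append_of_eq h'' heq hB) (by
          rw [val_append, val_inv]
          simp only [val_cons] at hv' ⊢
          rw [mul_assoc, hv', inv_mul_cancel_left, inv_mul_cancel]
          exact one_mem B)
        simp at this
      have := ih (isReduced_cons.1 h).2.1 (isReduced_cons.1 h').2.1 hB (by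
        simp only [val_cons] at hv'
        rw [mul_assoc, hv', inv_mul_cancel_left])
      simp [this]

theorem hasLen_unique (hA : IsAmalgam X B) {g : Γ} {m n : ℕ} (hm : HasLen X B g m)
    (hn : HasLen X B g n) : m = n := by
  obtain ⟨l, hl, rfl, b, hb, hv⟩ := hm
  obtain ⟨l', hl', rfl, b', hb', hv'⟩ := hn
  refine hA.length_eq hl hl' (mul_mem hb (inv_mem hb')) ?_
  rw [hv, hv', mul_assoc, inv_mul_cancel_left]

theorem mem_base_or (hA : IsAmalgam X B) (g :
    Γ) : g ∈ B ∨ ∃ p l, IsReduced X B (p :: l) ∧ val (p :: l) = g := by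
  obtain ⟨n, l, hl, -, b, hb, hv⟩ := hA.exists_hasLen g
  cases l with
  | nil => exact .inl ((Subgroup.mul_mem_cancel_left _ hb).1 (hv ▸ one_mem B))
  | cons p l =>
    refine .inr ⟨_, l, hl.mul_head hA.base_le (inv_mem hb), ?_⟩
    simp only [val_cons] at hv ⊢
    rw [mul_assoc, hv, inv_mul_cancel_left]

theorem hasLen_val {l : List (ι × Γ)} (h : IsReduced X B l) : HasLen X B (val l) l.length :=
  ⟨l, h, rfl, 1, one_mem B, by simp⟩

theorem mem_base_of_hasLen_zero {g : Γ} (h : HasLen X B g 0) : g ∈ B := by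
  obtain ⟨l, -, hl, b, hb, hv⟩ := h
  rw [List.length_eq_zero_iff.1 hl] at hv
  exact (Subgroup.mul_mem_cancel_left _ hb).1 (hv ▸ one_mem B)

theorem exists_mem_of_hasLen_one (hA : IsAmalgam X B) {g : Γ} (h : HasLen X B g 1) :
    ∃ i, g ∈ X i := by
  obtain ⟨l, hr, hl, b, hb, hv⟩ := h
  obtain ⟨p, rfl⟩ := List.length_eq_one_iff.1 hl
  refine ⟨p.1, (Subgroup.mul_mem_cancel_left _ (hA.base_le _ hb)).1 ?_⟩
  rw [← hv]
  simpa using (isReduced_cons.1 hr).1.1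

theorem hasLen_val_mul (hA : IsAmalgam X B) {l : List (ι × Γ)} (h : IsReduced X B l)
    {b : Γ} (hb : b ∈ B) :
    HasLen X B (val l * b) l.length := by
  cases hl : inv l with
  | nil =>
    obtain rfl : l = [] := by simpa [inv] using hl
    exact ⟨[], h, rfl, b⁻¹, inv_mem hb, by simp⟩
  | cons p l' =>
    have h' : IsReduced X B ((p.1, b⁻¹ * p.2) :: l') :=
      (hl ▸ h.inv).mul_head hA.base_le (inv_mem hb)
    refine ⟨_, h'.inv, ?_, 1, one_mem B, ?_⟩
    · rw [length_inv, ← length_inv l, hl]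
      rfl
    · have := val_inv l
      simp only [hl, val_cons] at this
      rw [val_inv, val_cons, mul_assoc, this]
      simp

theorem exists_hasLen_le_one {g : Γ} {i : ι} (h : g ∈ X i) : ∃ n ≤ 1, HasLen X B g n := by
  by_cases hg : g ∈ B
  · exact ⟨0, by simp, [], isReduced_nil, rfl, g⁻¹, inv_mem hg, by simp⟩
  · refine ⟨1, le_rfl, [(i, g)], ?_, rfl, 1, one_mem B, by simp⟩
    simp [isReduced_cons, h, hg, isReduced_nil]

/-- If `g⁻¹ * g'` is not longer than `g'` and `g` does not lie in the factor of the first syllable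
of `g'`, then the first syllables of `g` and `g'` agree up to the base. -/
theorem inv_mul_mem_base (hA : IsAmalgam X B) {p p' : ι × Γ} {l l' : List (ι × Γ)}
    (h : IsReduced X B (p :: l))
    (h' : IsReduced X B (p' :: l')) {n : ℕ} (hn : n ≤ (p' :: l').length)
    (hlen : HasLen X B ((val (p :: l))⁻¹ * val (p' :: l')) n) (hmem : val (p :: l) ∉ X p'.1) :
    p.1 = p'.1 ∧ p.2⁻¹ * p'.2 ∈ B := by
  have heq : p.1 = p'.1 := by
    by_contra hne
    have := hasLen_val (h.inv_append_of_ne h' hne)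
    rw [val_append, val_inv] at this
    have := hA.hasLen_unique hlen this
    simp at this hn
    omega
  refine ⟨heq, ?_⟩
  by_contra hB
  have := hasLen_val (h.inv_append_of_eq h' heq hB)
  have hval : val (Amalgam.inv l ++ (p'.1, p.2⁻¹ * p'.2) :: l') =
      (val (p :: l))⁻¹ * val (p' :: l') := by
    simp [mul_assoc]
  rw [hval] at this
  have := hA.hasLen_unique hlen this
  simp only [List.length_append, length_inv, List.length_cons] at this hn
  have hl : l = [] := List.length_eq_zero_iff.1 (by omega)
  subst hl
  refine hmem ?_
  simpa [← heq] using (isReduced_cons.1 h).1.1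

theorem exists_conj_le_of_forall_hasLen_le (hA : IsAmalgam X B) [Nonempty ι] (r : ℕ)
    (K : Subgroup Γ)
    (hK : ∀ g ∈ K, ∃ n ≤ r, HasLen X B g n) :
    ∃ (i : ι) (x : Γ), ∀ g ∈ K, x * g * x⁻¹ ∈ X i := by
  induction r using Nat.strong_induction_on generalizing K with
  | _ r ih =>
  by_cases hr : r ≤ 1
  · by_cases hKB : ∀ g ∈ K, g ∈ B
    · exact ⟨Classical.arbitrary ι, 1, fun g hg => by simpa using hA.base_le _ (hKB g hg)⟩
    push Not at hKB
    obtain ⟨g₀, hg₀, hg₀B⟩ := hKB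
    have key : ∀ g ∈ K, g ∉ B → ∃ i, g ∈ X i := by
      intro g hg hgB
      obtain ⟨n, hn, hlen⟩ := hK g hg
      obtain rfl | rfl : n = 0 ∨ n = 1 := by omega
      · exact absurd (mem_base_of_hasLen_zero hlen) hgB
      · exact hA.exists_mem_of_hasLen_one hlen
    obtain ⟨i, hi⟩ := key g₀ hg₀ hg₀B
    refine ⟨i, 1, fun g hg => ?_⟩
    rw [one_mul, inv_one, mul_one]
    by_cases hgB : g ∈ B
    · exact hA.base_le i hgB
    obtain ⟨j, hj⟩ := key g hg hgB
    by_contra hgi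
    have hij : i ≠ j := fun h => hgi (h ▸ hj)
    obtain ⟨n, hn, hlen⟩ := hK (g₀ * g) (mul_mem hg₀ hg)
    have hred : IsReduced X B [(i, g₀), (j, g)] := by
      simp [isReduced_cons, isReduced_nil, *]
    have := hasLen_val hred
    simp only [val_cons, val_nil, mul_one] at this
    have := hA.hasLen_unique hlen this
    simp at this
    omega
  by_cases hlt : ∀ g ∈ K, ∃ n ≤ r - 1, HasLen X B g n
  · exact ih (r - 1) (by omega) K hlt
  push Not at hlt
  obtain ⟨g₀, hg₀, hg₀len⟩ := hlt
  obtain hg₀B | ⟨p, l, hred, rfl⟩ := hA.mem_base_or g₀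
  · obtain ⟨n, hn, h⟩ := exists_hasLen_le_one (hA.base_le (Classical.arbitrary ι) hg₀B)
    exact absurd h (hg₀len n (by omega))
  have hlen : (p :: l).length = r := by
    obtain ⟨n, hn, h⟩ := hK _ hg₀
    have := hA.hasLen_unique h (hasLen_val hred)
    have : ¬ n ≤ r - 1 := fun h' => hg₀len n h' h
    omega
  have start : ∀ (p' : ι × Γ) (l' : List (ι × Γ)), IsReduced X B (p' :: l') →
      val (p' :: l') ∈ K → val (p' :: l') ∉ X p.1 → p'.1 = p.1 ∧ p'.2⁻¹ * p.2 ∈ B := by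
    intro p' l' h' hK' hX'
    obtain ⟨n, hn, h⟩ := hK _ (mul_mem (inv_mem hK') hg₀)
    exact hA.inv_mul_mem_base h' hred (hlen ▸ hn) h hX'
  obtain ⟨i, x, hx⟩ := ih (r - 1) (by omega) (K.map (MulAut.conj p.2⁻¹).toMonoidHom) (by
    rintro _ ⟨g, hg, rfl⟩
    simp only [MulEquiv.coe_toMonoidHom, MulAut.conj_apply, inv_inv]
    have hp := (isReduced_cons.1 hred).1
    by_cases hgX : g ∈ X p.1
    · obtain ⟨n, hn, h⟩ := exists_hasLen_le_one (mul_mem (mul_mem (inv_mem hp.1) hgX) hp.1)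
      exact ⟨n, by omega, h⟩
    obtain hgB | ⟨q, m, hqm, rfl⟩ := hA.mem_base_or g
    · exact absurd (hA.base_le _ hgB) hgX
    obtain ⟨hq1, hqB⟩ := start q m hqm hg hgX
    obtain rfl | ⟨m, z, rfl⟩ := List.eq_nil_or_concat' m
    · refine absurd ?_ hgX
      simpa [hq1] using (isReduced_cons.1 hqm).1.1
    have hinv : inv (q :: (m ++ [z])) = (z.1, z.2⁻¹) :: inv (q :: m) := by
      simp [inv]
    obtain ⟨hz1, hzB⟩ := start (z.1, z.2⁻¹) (inv (q :: m)) (hinv ▸ hqm.inv)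
      (by rw [← hinv, val_inv]; exact inv_mem hg)
      (by rw [← hinv, val_inv, inv_mem_iff]; exact hgX)
    have hm : IsReduced X B m := (isReduced_append.1 (isReduced_cons.1 hqm).2.1).1
    have hlen' : (q :: (m ++ [z])).length ≤ r := by
      obtain ⟨n, hn, h⟩ := hK _ hg
      rwa [← hA.hasLen_unique h (hasLen_val hqm)]
    obtain ⟨l', hl', hlen'', b, hb, hv⟩ :=
      hA.hasLen_val_mul hm (b := z.2 * p.2) (by simpa using hzB)
    refine ⟨m.length, ?_, l', hl', hlen'', b * (q.2⁻¹ * p.2), mul_mem hb hqB, ?_⟩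
    · simp at hlen'
      omega
    · rw [hv]
      simp [mul_assoc])
  refine ⟨i, x * p.2⁻¹, fun g hg => ?_⟩
  have := hx _ ⟨g, hg, rfl⟩
  simpa [mul_assoc] using this

end IsAmalgam

theorem IsAmalgam.exists_conj_le_of_finite {Γ ι : Type*} [Group Γ] {X : ι → Subgroup Γ}
    {B : Subgroup Γ} (hA : IsAmalgam X B) [Nonempty ι] (K : Subgroup Γ)
    (hK : (K : Set Γ).Finite) : ∃ (i : ι) (x : Γ), ∀ g ∈ K, x * g * x⁻¹ ∈ X i := by
  choose n hn using hA.exists_hasLen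
  obtain ⟨r, hr⟩ := (hK.image n).bddAbove
  exact hA.exists_conj_le_of_forall_hasLen_le r K fun g hg => ⟨n g, hr ⟨g, hg, rfl⟩, hn g⟩

end Amalgam

namespace Monoid.PushoutI

variable {ι : Type*} {M : ι → Type*} {H : Type*} [∀ i, Group (M i)] [Group H] {φ : ∀ i, H →* M i}

open Amalgam

theorem val_map_of (l : List (Σ i, M i)) :
    val (l.map fun s => (s.1, (of s.1 s.2 : PushoutI φ))) =
      (l.map fun s => (of s.1 s.2 : PushoutI φ)).prod := by
  simp [val, Function.comp_def]

theorem ofCoprodI_prod (w : CoprodI.Word M) :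
    (ofCoprodI w.prod : PushoutI φ) = (w.toList.map fun s => of s.1 s.2).prod := by
  simp [CoprodI.Word.prod, map_list_prod, Function.comp_def]

theorem of_mem_range_base (hφ : ∀ i, Function.Injective (φ i)) {i : ι} {g : M i} :
    (of i g : PushoutI φ) ∈ (base φ).range ↔ g ∈ (φ i).range := by
  constructor
  · rintro ⟨h, hh⟩
    refine ⟨h, of_injective hφ i ?_⟩
    rw [of_apply_eq_base, hh]
  · rintro ⟨h, rfl⟩
    exact ⟨h, (of_apply_eq_base φ i h).symm⟩

theorem isAmalgam (hφ : ∀ i, Function.Injective (φ i)) :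
    IsAmalgam (fun i => (of i : M i →* PushoutI φ).range) (base φ).range where
  base_le := by
    rintro i _ ⟨h, rfl⟩
    exact ⟨φ i h, of_apply_eq_base φ i h⟩
  exists_hasLen g := by
    classical
    obtain ⟨d⟩ := NormalWord.transversal_nonempty φ hφ
    obtain ⟨w, rfl⟩ := (NormalWord.equiv (d := d)).symm.surjective g
    refine ⟨_, w.toList.map fun s => (s.1, of s.1 s.2), ⟨?_, ?_⟩, rfl, (base φ w.head)⁻¹,
      inv_mem ⟨_, rfl⟩, ?_⟩
    · intro p hp
      obtain ⟨⟨i, m⟩, hm, rfl⟩ := List.mem_map.1 hp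
      refine ⟨⟨m, rfl⟩, fun hB => w.ne_one _ hm ?_⟩
      have hset := w.normalized i m hm
      have := (d.compl i).1 (a₁ := (⟨m, (of_mem_range_base hφ).1 hB⟩, ⟨1, d.one_mem i⟩))
        (a₂ := (⟨1, one_mem _⟩, ⟨m, hset⟩)) (by simp)
      simpa using congrArg (fun x => (x.1 : M i)) this
    · rw [List.isChain_map]
      exact w.chain_ne
    · rw [val_map_of, ← ofCoprodI_prod]
      change _ = _ * NormalWord.prod w
      rw [NormalWord.prod, inv_mul_cancel_left]
  eq_nil l hl hB := by
    have : l ∈ Set.range (List.map fun s : Σ i, M i => (s.1, (of s.1 s.2 : PushoutI φ))) := by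
      rw [Set.range_list_map]
      intro p hp
      obtain ⟨m, hm⟩ := (hl.1 p hp).1
      exact ⟨⟨p.1, m⟩, Prod.ext rfl hm⟩
    obtain ⟨l', rfl⟩ := this
    have hred : ∀ s ∈ l', s.2 ∉ (φ s.1).range := fun s hs h =>
      (hl.1 _ (List.mem_map_of_mem hs)).2 ((of_mem_range_base hφ).2 h)
    let w : CoprodI.Word M :=
      { toList := l'
        ne_one := fun s hs h => hred s hs (h ▸ one_mem _)
        chain_ne := by simpa [List.isChain_map] using hl.2 }
    have hw : w = .empty := Reduced.eq_empty_of_mem_range hφ (w := w) hred (by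
      rwa [ofCoprodI_prod, ← val_map_of])
    have : l' = [] := congrArg CoprodI.Word.toList hw
    rw [this, List.map_nil]

theorem exists_conj_of_finite [Nonempty ι] (hφ : ∀ i, Function.Injective (φ i))
    (K : Subgroup (PushoutI φ)) (hK : (K : Set (PushoutI φ)).Finite) :
    ∃ (i : ι) (x : PushoutI φ), ∀ g ∈ K, x * g * x⁻¹ ∈ (of i : M i →* PushoutI φ).range :=
  (isAmalgam hφ).exists_conj_le_of_finite K hK

end Monoid.PushoutI

namespace Monoid.CoprodI

variable {ι : Type*} {M : ι → Type*} [∀ i, Group (M i)]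

theorem exists_conj_of_finite [Nonempty ι] (K : Subgroup (CoprodI M))
    (hK : (K : Set (CoprodI M)).Finite) :
    ∃ (i : ι) (x : CoprodI M), ∀ g ∈ K, x * g * x⁻¹ ∈ (of : M i →* CoprodI M).range := by
  let φ : ∀ i, Unit →* M i := fun _ => 1
  have hφ : ∀ i, Function.Injective (φ i) := fun _ => Function.injective_of_subsingleton _
  let Φ : CoprodI M →* PushoutI φ := PushoutI.ofCoprodI
  let Ψ : PushoutI φ →* CoprodI M := PushoutI.lift (fun _ => of) 1 fun i => by
    ext; simp [φ]
  have hΨΦ : ∀ g, Ψ (Φ g) = g := by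
    have : Ψ.comp Φ = MonoidHom.id _ := by
      ext i m
      simp [Φ, Ψ]
    exact fun g => DFunLike.congr_fun this g
  obtain ⟨i, x, hx⟩ := PushoutI.exists_conj_of_finite hφ (K.map Φ) (hK.image Φ)
  refine ⟨i, Ψ x, fun g hg => ?_⟩
  obtain ⟨m, hm⟩ := hx _ ⟨g, hg, rfl⟩
  refine ⟨m, ?_⟩
  have := congrArg Ψ hm
  rw [map_mul, map_mul, map_inv, hΨΦ] at this
  rw [← this]
  simp [Ψ]

/-- A homomorphism of free products is injective if it sends the nontrivial elements of different
factors to words whose outer letters have different colours. -/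
theorem lift_injective_of_colouring {κ : Type*} {N : κ → Type*} [∀ i, Group (N i)]
    (f : ∀ i, M i →* CoprodI N) (c : κ → ι)
    (hf : ∀ i (m : M i), m ≠ 1 →
      ∃ (a b : κ) (v : NeWord N a b), v.prod = f i m ∧ c a = i ∧ c b = i) :
    Function.Injective (lift f) := by
  classical
  have key : ∀ {i j} (w : NeWord M i j),
      ∃ (a b : κ) (v : NeWord N a b), v.prod = lift f w.prod ∧ c a = i ∧ c b = j := by
    intro i j w
    induction w with
    | singleton m hm => simpa using hf _ m hm
    | append w₁ hne w₂ ih₁ ih₂ =>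
      obtain ⟨a, b, v, hv, ha, hb⟩ := ih₁
      obtain ⟨a', b', v', hv', ha', hb'⟩ := ih₂
      refine ⟨a, b', v.append (fun h => hne ?_) v', ?_, ha, hb'⟩
      · rw [← hb, ← ha', h]
      · simp [hv, hv']
  rw [injective_iff_map_eq_one]
  intro g hg
  obtain ⟨w, rfl⟩ := Word.equiv.symm.surjective g
  by_contra hne
  have hw : w ≠ .empty := by
    rintro rfl
    exact hne (by simp [Word.equiv])
  obtain ⟨i, j, w', rfl⟩ := NeWord.of_word w hw
  obtain ⟨a, b, v, hv, -, -⟩ := key w'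
  have : v.toWord.prod = (Word.empty : Word N).prod := by
    rw [Word.prod_empty, ← hg]
    exact hv
  have := Word.equiv.symm.injective (a₁ := v.toWord) (a₂ := .empty) this
  exact v.toList_ne_nil (congrArg Word.toList this)

end Monoid.CoprodI

open Monoid

/-- The free product of `m` copies of `G`. -/
abbrev Copies (G : Type*) [Group G] (m : ℕ) : Type _ := CoprodI fun _ : Fin m => G

namespace Copies

variable {G : Type*} [Group G]

/-- The homomorphism of free products of copies of `G` given by a map of indices. -/
def map (G : Type*) [Group G] {m n : ℕ} (e : Fin m → Fin n) : Copies G m →* Copies G n :=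
  CoprodI.lift fun i => CoprodI.of (M := fun _ : Fin n => G) (i := e i)

@[simp]
theorem map_of {m n : ℕ} (e : Fin m → Fin n) (i : Fin m) (g : G) :
    map G e (CoprodI.of (i := i) g) = CoprodI.of (M := fun _ : Fin n => G) (i := e i) g := by
  simp [map]

theorem exists_neWord_map {m n : ℕ} {e : Fin m → Fin n} (he : Function.Injective e)
    {p : Copies G m} (hp : p ≠ 1) :
    ∃ (i j : Fin m) (v : CoprodI.NeWord (fun _ : Fin n => G) (e i) (e j)), v.prod = map G e p := by
  classical
  have key : ∀ {i j} (w : CoprodI.NeWord (fun _ : Fin m => G) i j),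
      ∃ v : CoprodI.NeWord (fun _ : Fin n => G) (e i) (e j), v.prod = map G e w.prod := by
    intro i j w
    induction w with
    | singleton g hg => exact ⟨.singleton g hg, by simp⟩
    | append w₁ hne w₂ ih₁ ih₂ =>
      obtain ⟨v₁, h₁⟩ := ih₁
      obtain ⟨v₂, h₂⟩ := ih₂
      exact ⟨v₁.append (he.ne hne) v₂, by simp [h₁, h₂]⟩
  obtain ⟨w, rfl⟩ := CoprodI.Word.equiv.symm.surjective p
  have hw : w ≠ .empty := by
    rintro rfl
    exact hp (by simp [CoprodI.Word.equiv])
  obtain ⟨i, j, w', rfl⟩ := CoprodI.NeWord.of_word w hw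
  obtain ⟨v, hv⟩ := key w'
  exact ⟨i, j, v, hv⟩

/-- Double coset representatives for the free factors omitting the first, respectively the last,
copy of `G`. -/
theorem exists_eq_succ_mul_mul_castSucc {m : ℕ} (n : Copies G (m + 1)) :
    ∃ (q p : Copies G m) (y : Copies G (m + 1)),
      n = map G Fin.succ q * y * map G Fin.castSucc p ∧
      (y = 1 ∨ ∃ v : CoprodI.NeWord (fun _ : Fin (m + 1) => G) 0 (Fin.last m), v.prod = y) := by
  classical
  obtain ⟨⟨l, hl1, hlc⟩, rfl⟩ := CoprodI.Word.equiv.symm.surjective n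
  change ∃ (q p : Copies G m) (y : Copies G (m + 1)),
    (l.map fun s => CoprodI.of (M := fun _ : Fin (m + 1) => G) s.2).prod =
      map G Fin.succ q * y * map G Fin.castSucc p ∧ _
  induction hr : l.length generalizing l with
  | zero =>
    obtain rfl := List.length_eq_zero_iff.1 hr
    exact ⟨1, 1, 1, by simp⟩
  | succ r ih =>
    have hne : l ≠ [] := by rintro rfl; simp at hr
    obtain ⟨i, j, v, hv⟩ := CoprodI.NeWord.of_word ⟨l, hl1, hlc⟩ fun h =>
      hne (congrArg CoprodI.Word.toList h)
    have hv' : v.toList = l := congrArg CoprodI.Word.toList hv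
    by_cases hi : i = 0
    · by_cases hj : j = Fin.last m
      · subst hi hj
        refine ⟨1, 1, v.prod, ?_, .inr ⟨v, rfl⟩⟩
        simp only [map_one, one_mul, mul_one]
        rw [CoprodI.NeWord.prod, hv]
        rfl
      · obtain ⟨j, rfl⟩ := Fin.exists_castSucc_eq.2 hj
        obtain ⟨l', s, rfl⟩ := (List.eq_nil_or_concat' l).resolve_left hne
        have hs : s = ⟨j.castSucc, v.last⟩ := by
          simpa [hv'] using v.toList_getLast?
        obtain ⟨q, p, y, h, hy⟩ := ih l' (fun s hs => hl1 s (by simp [hs]))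
          hlc.left_of_append (by simpa using hr)
        refine ⟨q, p * CoprodI.of (i := j) v.last, y, ?_, hy⟩
        rw [List.map_append, List.prod_append, h, hs]
        simp [mul_assoc]
    · obtain ⟨i, rfl⟩ := Fin.exists_succ_eq.2 hi
      obtain ⟨s, l', rfl⟩ := List.exists_cons_of_ne_nil hne
      have hs : s = ⟨i.succ, v.head⟩ := by
        simpa [hv'] using v.toList_head?
      obtain ⟨q, p, y, h, hy⟩ := ih l' (fun s hs => hl1 s (by simp [hs]))
        hlc.tail (by simpa using hr)
      refine ⟨CoprodI.of (i := i) v.head * q, p, y, ?_, hy⟩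
      rw [List.map_cons, List.prod_cons, h, hs]
      simp [mul_assoc]

/-- The homomorphism to `F` sending the copy of `G` with index `i` to `t⁻ⁱ G tⁱ`. -/
def ev (G : Type*) [Group G] (m : ℕ) : Copies G m →* FP G :=
  CoprodI.lift fun i => (MulAut.conj (tgen G ^ (i : ℕ))⁻¹).toMonoidHom.comp (emb G)

theorem ev_of {m : ℕ} (i : Fin m) (g : G) :
    ev G m (CoprodI.of (i := i) g) = (tgen G ^ (i : ℕ))⁻¹ * emb G g * tgen G ^ (i : ℕ) := by
  rw [ev, CoprodI.lift_of]
  simp only [MonoidHom.comp_apply, MulEquiv.coe_toMonoidHom, MulAut.conj_apply, inv_inv]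

theorem ev_castSucc {m : ℕ} (p : Copies G m) : ev G (m + 1) (map G Fin.castSucc p) = ev G m p := by
  have : (ev G (m + 1)).comp (map G Fin.castSucc) = ev G m := by
    ext i g
    simp [ev_of]
  exact DFunLike.congr_fun this p

theorem ev_succ {m : ℕ} (p : Copies G m) :
    ev G (m + 1) (map G Fin.succ p) = (tgen G)⁻¹ * ev G m p * tgen G := by
  have : (ev G (m + 1)).comp (map G Fin.succ) =
      (MulAut.conj (tgen G)⁻¹).toMonoidHom.comp (ev G m) := by
    ext i g
    simp [ev_of, pow_succ, mul_assoc]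
  simpa using DFunLike.congr_fun this p

end Copies

section Unimodular

variable {G : Type*} [Group G]

open Copies

/-- `f` lies in the subgroup generated by the conjugates of `G` by sufficiently many powers
of `t`. -/
def EventuallyInRange (f : FP G) : Prop :=
  ∃ c : ℕ, ∀ a ≥ c, ∀ m ≥ a + c, (tgen G ^ a)⁻¹ * f * tgen G ^ a ∈ (ev G m).range

theorem EventuallyInRange.mul {f f' : FP G} (h : EventuallyInRange f)
    (h' : EventuallyInRange f') : EventuallyInRange (f * f') := by
  obtain ⟨c, hc⟩ := h
  obtain ⟨c', hc'⟩ := h'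
  refine ⟨max c c', fun a ha m hm => ?_⟩
  convert mul_mem (hc a (by omega) m (by omega)) (hc' a (by omega) m (by omega)) using 1
  group

theorem eventuallyInRange_one : EventuallyInRange (1 : FP G) :=
  ⟨0, fun a _ m _ => by simp⟩

theorem eventuallyInRange_conj (j : ℤ) (g : G) :
    EventuallyInRange (tgen G ^ j * emb G g * tgen G ^ (-j)) := by
  refine ⟨j.natAbs + 1, fun a ha m hm => ?_⟩
  obtain ⟨i, hi⟩ := Int.eq_ofNat_of_zero_le (show 0 ≤ a - j by omega)
  refine ⟨CoprodI.of (i := ⟨i, by omega⟩) g, ?_⟩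
  rw [ev_of, ← zpow_natCast, ← zpow_natCast]
  simp only [← hi]
  group

theorem eventuallyInRange_mul_zpow (f : FP G) (j : ℤ) :
    EventuallyInRange (tgen G ^ j * f * tgen G ^ (-j - (expSum G f).toAdd)) := by
  have hmul : ∀ f f' : FP G,
      (∀ j : ℤ, EventuallyInRange (tgen G ^ j * f * tgen G ^ (-j - (expSum G f).toAdd))) →
      (∀ j : ℤ, EventuallyInRange (tgen G ^ j * f' * tgen G ^ (-j - (expSum G f').toAdd))) →
      ∀ j : ℤ, EventuallyInRange
        (tgen G ^ j * (f * f') * tgen G ^ (-j - (expSum G (f * f')).toAdd)) := by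
    intro f f' h h' j
    convert (h j).mul (h' (j + (expSum G f).toAdd)) using 1
    rw [map_mul, toAdd_mul]
    group
  induction f using Coprod.induction_on generalizing j with
  | inl g => simpa [expSum, emb] using eventuallyInRange_conj j g
  | inr x =>
    induction x using FreeGroup.induction_on generalizing j with
    | C1 => simpa using eventuallyInRange_one
    | of x =>
      convert eventuallyInRange_one using 1
      change tgen G ^ j * tgen G * tgen G ^ (-j - (expSum G (tgen G)).toAdd) = 1
      simp only [tgen, expSum, Coprod.lift_apply_inr, FreeGroup.lift_apply_of, toAdd_ofAdd]
      group
    | inv_of x _ =>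
      convert eventuallyInRange_one using 1
      rw [map_inv, map_inv, toAdd_inv]
      change tgen G ^ j * (tgen G)⁻¹ * tgen G ^ (-j - -(expSum G (tgen G)).toAdd) = 1
      simp only [tgen, expSum, Coprod.lift_apply_inr, FreeGroup.lift_apply_of, toAdd_ofAdd]
      group
    | mul x y hx hy =>
      rw [map_mul]
      exact hmul _ _ hx hy j
  | mul f f' h h' => exact hmul f f' h h' j

theorem Unimodular.exists_conj_eq_ev_mul {w : FP G} (hw : Unimodular w) :
    ∃ (m : ℕ) (n : Copies G (m + 1)) (x : FP G), x * w * x⁻¹ = ev G (m + 1) n * tgen G := by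
  obtain ⟨c, hc⟩ := eventuallyInRange_mul_zpow w 0
  obtain ⟨n, hn⟩ := hc c le_rfl (2 * c + 1) (by omega)
  refine ⟨2 * c, n, (tgen G ^ c)⁻¹, ?_⟩
  rw [hn, hw]
  simp only [toAdd_ofAdd]
  group

theorem Unimodular.exists_conj_eq_ev_mul_castSucc {w : FP G} (hw : Unimodular w) :
    ∃ (m : ℕ) (y : Copies G (m + 1)) (p : Copies G m) (x : FP G),
      x * w * x⁻¹ = ev G (m + 1) (y * map G Fin.castSucc p) * tgen G ∧
      (m = 0 ∨ ∃ v : CoprodI.NeWord (fun _ : Fin (m + 1) => G) 0 (Fin.last m), v.prod = y) := by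
  classical
  have hex := hw.exists_conj_eq_ev_mul
  obtain ⟨m, ⟨n, x, hx⟩, hmin⟩ : ∃ m, (∃ (n : Copies G (m + 1)) (x : FP G),
      x * w * x⁻¹ = ev G (m + 1) n * tgen G) ∧ ∀ m' < m, ¬ ∃ (n : Copies G (m' + 1)) (x : FP G),
      x * w * x⁻¹ = ev G (m' + 1) n * tgen G :=
    ⟨Nat.find hex, Nat.find_spec hex, fun _ => Nat.find_min hex⟩
  obtain ⟨q, p, y, rfl, hy⟩ := exists_eq_succ_mul_mul_castSucc n
  have hconj : ((ev G (m + 1) (map G Fin.succ q))⁻¹ * x) * w *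
      ((ev G (m + 1) (map G Fin.succ q))⁻¹ * x)⁻¹ =
      ev G (m + 1) (y * map G Fin.castSucc (p * q)) * tgen G := by
    calc _ = (ev G (m + 1) (map G Fin.succ q))⁻¹ * (x * w * x⁻¹) *
          ev G (m + 1) (map G Fin.succ q) := by group
      _ = _ := by
        rw [hx]
        simp only [map_mul, ev_succ, ev_castSucc]
        group
  refine ⟨m, y, p * q, _, hconj, ?_⟩
  obtain rfl | hv := hy
  · cases m with
    | zero => exact .inl rfl
    | succ m =>
      rw [one_mul, ev_castSucc] at hconj
      exact (hmin m (by omega) ⟨p * q, _, hconj⟩).elim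
  · exact .inr hv

end Unimodular

universe u

/-- The family of types indexed by `Bool` with values `A` at `true` and `B` at `false`. -/
def PairFam (A B : Type u) : Bool → Type u
  | true => A
  | false => B

namespace PairFam

variable {A B : Type u} [Group A] [Group B]

instance : ∀ b, Group (PairFam A B b)
  | true => inferInstanceAs (Group A)
  | false => inferInstanceAs (Group B)

/-- A pair of homomorphisms into `C` as a family. -/
def homFrom {C : Type*} [Group C] (f : A →* C) (g : B →* C) : ∀ b, PairFam A B b →* C
  | true => f
  | false => g

/-- A pair of homomorphisms out of `C` as a family. -/
def homTo {C : Type*} [Group C] (f : C →* A) (g : C →* B) : ∀ b, C →* PairFam A B b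
  | true => f
  | false => g

end PairFam

/-- The free product of two groups in the same universe. -/
abbrev FreeProd (A B : Type u) [Group A] [Group B] : Type u := CoprodI (PairFam A B)

namespace FreeProd

variable {A B : Type u} [Group A] [Group B]

/-- The embedding of the first factor. -/
def inl : A →* FreeProd A B := CoprodI.of (M := PairFam A B) (i := true)

/-- The embedding of the second factor. -/
def inr : B →* FreeProd A B := CoprodI.of (M := PairFam A B) (i := false)

/-- The homomorphism given by homomorphisms on the two factors. -/
def lift {C : Type*} [Group C] (f : A →* C) (g : B →* C) : FreeProd A B →* C :=
  CoprodI.lift (PairFam.homFrom f g)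

@[simp]
theorem lift_inl {C : Type*} [Group C] (f : A →* C) (g : B →* C) (a : A) :
    lift f g (inl a) = f a :=
  CoprodI.lift_of (M := PairFam A B) (i := true) _ _

@[simp]
theorem lift_inr {C : Type*} [Group C] (f : A →* C) (g : B →* C) (b : B) :
    lift f g (inr b) = g b :=
  CoprodI.lift_of (M := PairFam A B) (i := false) _ _

theorem exists_conj_of_finite (K : Subgroup (FreeProd A B))
    (hK : (K : Set (FreeProd A B)).Finite) :
    ∃ x, (∀ g ∈ K, x * g * x⁻¹ ∈ (inl : A →* FreeProd A B).range) ∨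
      ∀ g ∈ K, x * g * x⁻¹ ∈ (inr : B →* FreeProd A B).range := by
  obtain ⟨i, x, hx⟩ := CoprodI.exists_conj_of_finite K hK
  cases i with
  | true => exact ⟨x, .inl hx⟩
  | false => exact ⟨x, .inr hx⟩

end FreeProd

/-- The free product of `A` and `B` amalgamated along `f : H →* A` and `g : H →* B`. -/
abbrev AmalgProd {A B H : Type u} [Group A] [Group B] [Group H] (f : H →* A) (g : H →* B) :
    Type u :=
  PushoutI (PairFam.homTo f g)

namespace AmalgProd

variable {A B H : Type u} [Group A] [Group B] [Group H] {f : H →* A} {g : H →* B}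

/-- The homomorphism from the first factor. -/
def inl : A →* AmalgProd f g := PushoutI.of (φ := PairFam.homTo f g) true

/-- The homomorphism from the second factor. -/
def inr : B →* AmalgProd f g := PushoutI.of (φ := PairFam.homTo f g) false

theorem inl_apply_eq_inr_apply (h : H) :
    (inl (f h) : AmalgProd f g) = inr (g h) :=
  (PushoutI.of_apply_eq_base (PairFam.homTo f g) true h).trans
    (PushoutI.of_apply_eq_base (PairFam.homTo f g) false h).symm

/-- The homomorphism given by compatible homomorphisms on the two factors. -/
def lift {C : Type*} [Group C] (a : A →* C) (b : B →* C) (h : b.comp g = a.comp f) :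
    AmalgProd f g →* C :=
  PushoutI.lift (PairFam.homFrom a b) (a.comp f) fun i =>
    match i with
    | true => rfl
    | false => h

@[simp]
theorem lift_inl {C : Type*} [Group C] (a : A →* C) (b : B →* C) (h : b.comp g = a.comp f)
    (x : A) : lift a b h (inl x) = a x :=
  PushoutI.lift_of (φ := PairFam.homTo f g) (i := true) _ _ _ _

@[simp]
theorem lift_inr {C : Type*} [Group C] (a : A →* C) (b : B →* C) (h : b.comp g = a.comp f)
    (x : B) : lift a b h (inr x) = b x :=
  PushoutI.lift_of (φ := PairFam.homTo f g) (i := false) _ _ _ _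

theorem homTo_injective (hf : Function.Injective f) (hg : Function.Injective g) :
    ∀ b, Function.Injective (PairFam.homTo f g b)
  | true => hf
  | false => hg

theorem inl_injective (hf : Function.Injective f) (hg : Function.Injective g) :
    Function.Injective (inl : A →* AmalgProd f g) :=
  PushoutI.of_injective (homTo_injective hf hg) true

theorem inr_injective (hf : Function.Injective f) (hg : Function.Injective g) :
    Function.Injective (inr : B →* AmalgProd f g) :=
  PushoutI.of_injective (homTo_injective hf hg) false

theorem exists_conj_of_finite (hf : Function.Injective f) (hg : Function.Injective g)
    (K : Subgroup (AmalgProd f g)) (hK : (K : Set (AmalgProd f g)).Finite) :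
    ∃ x, (∀ k ∈ K, x * k * x⁻¹ ∈ (inl : A →* AmalgProd f g).range) ∨
      ∀ k ∈ K, x * k * x⁻¹ ∈ (inr : B →* AmalgProd f g).range := by
  obtain ⟨i, x, hx⟩ := PushoutI.exists_conj_of_finite (homTo_injective hf hg) K hK
  cases i with
  | true => exact ⟨x, .inl hx⟩
  | false => exact ⟨x, .inr hx⟩

end AmalgProd

theorem Subgroup.exists_finite_of_conj_mem_range {M Γ : Type*} [Group M] [Group Γ] {f : M →* Γ}
    (hf : Function.Injective f) {K : Subgroup Γ} (hK : (K : Set Γ).Finite) {x : Γ}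
    (hx : ∀ g ∈ K, x * g * x⁻¹ ∈ f.range) :
    ∃ K' : Subgroup M, (K' : Set M).Finite ∧ ∀ g ∈ K, ∃ m ∈ K', f m = x * g * x⁻¹ := by
  refine ⟨(K.map (MulAut.conj x).toMonoidHom).comap f, ?_, fun g hg => ?_⟩
  · exact Set.Finite.preimage (f := f) hf.injOn (hK.image (MulAut.conj x))
  · obtain ⟨m, hm⟩ := hx g hg
    exact ⟨m, ⟨g, hg, hm.symm⟩, hm⟩

section Splitting

variable {G : Type u} [Group G] {m : ℕ} {C : Type u} [Group C]

open Copies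

/-- Two copies of the free product of `m` copies of `G`. -/
abbrev Doubled (G : Type u) [Group G] (m : ℕ) : Type u := CoprodI fun _ : Bool => Copies G m

/-- The subgroup of `G ∗ ⋯ ∗ G` generated by the last factors and by a conjugate of the first
factors. -/
def toCopies (y : Copies G (m + 1)) : Doubled G m →* Copies G (m + 1) :=
  CoprodI.lift fun b => match b with
    | true => map G Fin.succ
    | false => (MulAut.conj y).toMonoidHom.comp (map G Fin.castSucc)

@[simp]
theorem toCopies_true (y : Copies G (m + 1)) (p : Copies G m) :
    toCopies y (CoprodI.of (i := true) p) = map G Fin.succ p := by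
  rw [toCopies, CoprodI.lift_of]

@[simp]
theorem toCopies_false (y : Copies G (m + 1)) (p : Copies G m) :
    toCopies y (CoprodI.of (i := false) p) = y * map G Fin.castSucc p * y⁻¹ := by
  rw [toCopies, CoprodI.lift_of]
  rfl

/-- The subgroup of `G ∗ ⋯ ∗ G ∗ C` generated by the first factors and by a conjugate of them. -/
def toFreeProd (p₀ : Copies G m) (s : C) : Doubled G m →* FreeProd (Copies G m) C :=
  CoprodI.lift fun b => match b with
    | true => (MulAut.conj (FreeProd.inr s⁻¹ * FreeProd.inl p₀)).toMonoidHom.comp FreeProd.inl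
    | false => FreeProd.inl

@[simp]
theorem toFreeProd_true (p₀ : Copies G m) (s : C) (p : Copies G m) :
    toFreeProd p₀ s (CoprodI.of (i := true) p) =
      FreeProd.inr s⁻¹ * FreeProd.inl (p₀ * p * p₀⁻¹) * FreeProd.inr s := by
  rw [toFreeProd, CoprodI.lift_of]
  simp only [MonoidHom.comp_apply, MulEquiv.coe_toMonoidHom, MulAut.conj_apply]
  simp only [map_mul, map_inv]
  group

@[simp]
theorem toFreeProd_false (p₀ : Copies G m) (s : C) (p : Copies G m) :
    toFreeProd p₀ s (CoprodI.of (i := false) p) = FreeProd.inl p := by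
  rw [toFreeProd, CoprodI.lift_of]

theorem toCopies_injective {y : Copies G (m + 1)} (hy : m = 0 ∨
    ∃ v : CoprodI.NeWord (fun _ : Fin (m + 1) => G) 0 (Fin.last m), v.prod = y) :
    Function.Injective (toCopies y) := by
  refine CoprodI.lift_injective_of_colouring _ (fun a : Fin (m + 1) => decide (a ≠ 0)) ?_
  intro b p hp
  cases b with
  | true =>
    obtain ⟨i, j, v, hv⟩ := exists_neWord_map (Fin.succ_injective m) hp
    exact ⟨_, _, v, hv, by simp⟩
  | false =>
    obtain ⟨i, j, v, hv⟩ := exists_neWord_map (Fin.castSucc_injective m) hp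
    obtain rfl | ⟨u, rfl⟩ := hy
    · exact i.elim0
    · refine ⟨0, 0, (u.append (Fin.castSucc_lt_last i).ne' v).append
        (Fin.castSucc_lt_last j).ne u.inv, ?_, by simp⟩
      simp [hv]

theorem toFreeProd_injective (p₀ : Copies G m) {s : C} (hs : s ≠ 1) :
    Function.Injective (toFreeProd p₀ s) := by
  refine CoprodI.lift_injective_of_colouring _ Bool.not ?_
  intro b p hp
  cases b with
  | true =>
    let v₁ : CoprodI.NeWord (PairFam (Copies G m) C) false false := .singleton s⁻¹ (inv_ne_one.2 hs)
    let v₂ : CoprodI.NeWord (PairFam (Copies G m) C) true true :=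
      .singleton (p₀ * p * p₀⁻¹) (conj_eq_one_iff.not.2 hp)
    let v₃ : CoprodI.NeWord (PairFam (Copies G m) C) false false := .singleton s hs
    refine ⟨false, false, (v₁.append (by decide) v₂).append (by decide) v₃, ?_, rfl, rfl⟩
    exact (toFreeProd_true p₀ s p).symm
  | false =>
    let v : CoprodI.NeWord (PairFam (Copies G m) C) true true := .singleton p hp
    exact ⟨true, true, v, (toFreeProd_false p₀ s p).symm, rfl, rfl⟩

/-- The amalgamated product onto which `F` maps so that `ev (y * p₀) * t` goes to `s`. -/
abbrev Splitting (y : Copies G (m + 1)) (p₀ : Copies G m) (s : C) : Type u :=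
  AmalgProd (toCopies y) (toFreeProd p₀ s)

namespace Splitting

variable (y : Copies G (m + 1)) (p₀ : Copies G m) (s : C)

/-- The image of `t` under `ofFP`. -/
def stable : Splitting y p₀ s :=
  (AmalgProd.inl (y * map G Fin.castSucc p₀))⁻¹ * AmalgProd.inr (FreeProd.inr s)

theorem stable_conj (p : Copies G m) :
    (stable y p₀ s)⁻¹ * AmalgProd.inl (map G Fin.castSucc p) * stable y p₀ s =
      AmalgProd.inl (map G Fin.succ p) := by
  have h := AmalgProd.inl_apply_eq_inr_apply (f := toCopies y) (g := toFreeProd p₀ s)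
    (CoprodI.of (i := false) (p₀ * p * p₀⁻¹))
  have h' := AmalgProd.inl_apply_eq_inr_apply (f := toCopies y) (g := toFreeProd p₀ s)
    (CoprodI.of (i := true) p)
  rw [toCopies_false, toFreeProd_false] at h
  rw [toCopies_true, toFreeProd_true] at h'
  rw [h']
  simp only [map_mul, map_inv] at h ⊢
  rw [← h, stable]
  simp only [map_mul]
  group

/-- The homomorphism from `F` sending `t` to `stable`. -/
def ofFP : FP G →* Splitting y p₀ s :=
  Coprod.lift (AmalgProd.inl.comp (CoprodI.of (M := fun _ : Fin (m + 1) => G) (i := 0)))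
    (FreeGroup.lift fun _ => stable y p₀ s)

@[simp]
theorem ofFP_emb (g : G) : ofFP y p₀ s (emb G g) =
    AmalgProd.inl (CoprodI.of (M := fun _ : Fin (m + 1) => G) (i := 0) g) := by
  simp [ofFP, emb]

@[simp]
theorem ofFP_tgen : ofFP y p₀ s (tgen G) = stable y p₀ s := by
  simp [ofFP, tgen]

theorem ofFP_ev (l : Copies G (m + 1)) : ofFP y p₀ s (ev G (m + 1) l) = AmalgProd.inl l := by
  have : (ofFP y p₀ s).comp (ev G (m + 1)) = AmalgProd.inl := by
    ext i g
    simp only [MonoidHom.comp_apply, ev_of, map_mul, map_inv, map_pow, ofFP_emb, ofFP_tgen]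
    induction i using Fin.induction with
    | zero => simp
    | succ i ih =>
      have h := stable_conj y p₀ s (CoprodI.of (M := fun _ : Fin m => G) (i := i) g)
      rw [map_of, map_of, ← ih] at h
      rw [← h, Fin.val_succ, Fin.val_castSucc, pow_succ]
      group
  exact DFunLike.congr_fun this l

theorem ofFP_ev_mul_tgen :
    ofFP y p₀ s (ev G (m + 1) (y * map G Fin.castSucc p₀) * tgen G) =
      AmalgProd.inr (FreeProd.inr s) := by
  rw [map_mul, ofFP_ev, ofFP_tgen, stable, mul_inv_cancel_left]

variable {y p₀ s} {Q : Type*} [Group Q] (q : FP G →* Q) (c : C →* Q)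

/-- The homomorphism to `Q` induced by `q : F →* Q` and a compatible `c : C →* Q`. -/
def toQuot (hc : c s = q (ev G (m + 1) (y * map G Fin.castSucc p₀) * tgen G)) :
    Splitting y p₀ s →* Q :=
  AmalgProd.lift (q.comp (ev G (m + 1)))
    (FreeProd.lift
      ((q.comp (ev G (m + 1))).comp ((MulAut.conj y).toMonoidHom.comp (map G Fin.castSucc))) c)
    (by
      refine CoprodI.ext_hom _ _ fun b => MonoidHom.ext fun p => ?_
      cases b with
      | true =>
        simp only [MonoidHom.comp_apply, toCopies_true, toFreeProd_true, map_mul, map_inv,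
          FreeProd.lift_inl, FreeProd.lift_inr, hc, MulEquiv.coe_toMonoidHom, MulAut.conj_apply,
          ev_succ, ev_castSucc]
        group
      | false =>
        simp only [MonoidHom.comp_apply, toCopies_false, toFreeProd_false, FreeProd.lift_inl,
          MulEquiv.coe_toMonoidHom, MulAut.conj_apply])

variable (hc : c s = q (ev G (m + 1) (y * map G Fin.castSucc p₀) * tgen G))

@[simp]
theorem toQuot_inl (l : Copies G (m + 1)) :
    toQuot q c hc (AmalgProd.inl l) = q (ev G (m + 1) l) :=
  AmalgProd.lift_inl _ _ _ _

@[simp]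
theorem toQuot_inr_inr (a : C) :
    toQuot q c hc (AmalgProd.inr (FreeProd.inr a)) = c a := by
  simp [toQuot]

theorem toQuot_ofFP (f : FP G) : toQuot q c hc (ofFP y p₀ s f) = q f := by
  have : (toQuot q c hc).comp (ofFP y p₀ s) = q := by
    refine Coprod.hom_ext (MonoidHom.ext fun g => ?_) (FreeGroup.ext_hom _ _ fun _ => ?_)
    · change toQuot q c hc (ofFP y p₀ s (emb G g)) = q (emb G g)
      simp [ev_of]
    · change toQuot q c hc (ofFP y p₀ s (tgen G)) = q (tgen G)
      rw [ofFP_tgen, stable, map_mul, map_inv, toQuot_inl, toQuot_inr_inr, hc, map_mul q,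
        inv_mul_cancel_left]
  exact DFunLike.congr_fun this f

theorem exists_conj_of_finite (hy : m = 0 ∨
    ∃ v : CoprodI.NeWord (fun _ : Fin (m + 1) => G) 0 (Fin.last m), v.prod = y) (hs : s ≠ 1)
    (K : Subgroup (Splitting y p₀ s)) (hK : (K : Set (Splitting y p₀ s)).Finite) :
    ∃ x : Splitting y p₀ s,
      (∃ i, ∀ g ∈ K, ∃ a, AmalgProd.inl
        (CoprodI.of (M := fun _ : Fin (m + 1) => G) (i := i) a) = x * g * x⁻¹) ∨
      ∀ g ∈ K, ∃ a, AmalgProd.inr (FreeProd.inr a) = x * g * x⁻¹ := by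
  have hL := toCopies_injective hy
  have hX := toFreeProd_injective p₀ hs
  have key : ∀ x : Splitting y p₀ s,
      (∀ g ∈ K, x * g * x⁻¹ ∈ (AmalgProd.inl : Copies G (m + 1) →* Splitting y p₀ s).range) →
      ∃ x : Splitting y p₀ s, ∃ i, ∀ g ∈ K, ∃ a, AmalgProd.inl
        (CoprodI.of (M := fun _ : Fin (m + 1) => G) (i := i) a) = x * g * x⁻¹ := by
    intro x hx
    obtain ⟨K', hK', h⟩ := Subgroup.exists_finite_of_conj_mem_range
      (AmalgProd.inl_injective hL hX) hK hx
    obtain ⟨i, z, hz⟩ := CoprodI.exists_conj_of_finite K' hK'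
    refine ⟨AmalgProd.inl z * x, i, fun g hg => ?_⟩
    obtain ⟨l, hl, hlg⟩ := h g hg
    obtain ⟨a, ha⟩ := hz l hl
    refine ⟨a, ?_⟩
    rw [ha, map_mul, map_mul, map_inv, hlg]
    group
  obtain ⟨x, hx | hx⟩ := AmalgProd.exists_conj_of_finite hL hX K hK
  · obtain ⟨x, i, hx⟩ := key x hx
    exact ⟨x, .inl ⟨i, hx⟩⟩
  · obtain ⟨K', hK', h⟩ := Subgroup.exists_finite_of_conj_mem_range
      (AmalgProd.inr_injective hL hX) hK hx
    obtain ⟨z, hz | hz⟩ := FreeProd.exists_conj_of_finite K' hK'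
    · obtain ⟨x, i, hx⟩ := key (AmalgProd.inr z * x) fun g hg => by
        obtain ⟨l, hl, hlg⟩ := h g hg
        obtain ⟨p, hp⟩ := hz l hl
        refine ⟨toCopies y (CoprodI.of (i := false) p), ?_⟩
        rw [AmalgProd.inl_apply_eq_inr_apply, toFreeProd_false, hp, map_mul, map_mul, map_inv, hlg]
        group
      exact ⟨x, .inl ⟨i, hx⟩⟩
    · refine ⟨AmalgProd.inr z * x, .inr fun g hg => ?_⟩
      obtain ⟨l, hl, hlg⟩ := h g hg
      obtain ⟨a, ha⟩ := hz l hl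
      refine ⟨a, ?_⟩
      rw [ha, map_mul, map_mul, map_inv, hlg]
      group

theorem exists_conj_of_finite_quotient
    (hc : c s = q (ev G (m + 1) (y * map G Fin.castSucc p₀) * tgen G)) (hy : m = 0 ∨
    ∃ v : CoprodI.NeWord (fun _ : Fin (m + 1) => G) 0 (Fin.last m), v.prod = y) (hs : s ≠ 1)
    (hq : Function.Surjective q) (hker : q.ker ≤ (ofFP y p₀ s).ker)
    (H : Subgroup Q) (hH : (H : Set Q).Finite) :
    ∃ x : Q, (∀ h ∈ H, x * h * x⁻¹ ∈ (q.comp (emb G)).range) ∨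
      ∀ h ∈ H, x * h * x⁻¹ ∈ c.range := by
  let Φ : Q →* Splitting y p₀ s := q.liftOfSurjective hq ⟨ofFP y p₀ s, hker⟩
  have hΦ : ∀ h, toQuot q c hc (Φ h) = h := by
    intro h
    obtain ⟨f, rfl⟩ := hq h
    rw [show Φ (q f) = ofFP y p₀ s f from MonoidHom.liftOfRightInverse_comp_apply _ _ _ _ _,
      toQuot_ofFP]
  obtain ⟨x, ⟨i, hx⟩ | hx⟩ := exists_conj_of_finite hy hs (H.map Φ) (hH.image Φ)
  · refine ⟨q (tgen G) ^ (i : ℕ) * toQuot q c hc x, .inl fun h hh => ?_⟩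
    obtain ⟨a, ha⟩ := hx _ ⟨h, hh, rfl⟩
    refine ⟨a, ?_⟩
    have := congrArg (toQuot q c hc) ha
    rw [toQuot_inl, ev_of] at this
    simp only [map_mul, map_inv, map_pow, hΦ] at this
    rw [MonoidHom.comp_apply, ← mul_right_inj (q (tgen G) ^ (i : ℕ))⁻¹,
      ← mul_left_inj (q (tgen G) ^ (i : ℕ)), this]
    group
  · refine ⟨toQuot q c hc x, .inr fun h hh => ?_⟩
    obtain ⟨a, ha⟩ := hx _ ⟨h, hh, rfl⟩
    refine ⟨a, ?_⟩
    have := congrArg (toQuot q c hc) ha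
    rwa [toQuot_inr_inr, map_mul, map_mul, map_inv, hΦ] at this

end Splitting

end Splitting

theorem Unimodular.mk_ne_one {G : Type*} [Group G] {w : FP G} (hw : Unimodular w) {k : ℕ}
    (hk : 2 ≤ k) : (QuotientGroup.mk' (Subgroup.normalClosure {w ^ k})) w ≠ 1 := by
  let f : FP G →* Multiplicative (ZMod k) :=
    (AddMonoidHom.toMultiplicative (Int.castAddHom (ZMod k))).comp (expSum G)
  have hfw : f w = Multiplicative.ofAdd 1 := by
    change AddMonoidHom.toMultiplicative (Int.castAddHom (ZMod k)) (expSum G w) = _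
    rw [hw]
    simp
  have hle : Subgroup.normalClosure {w ^ k} ≤ f.ker := by
    refine Subgroup.normalClosure_le_normal (Set.singleton_subset_iff.2 ?_)
    change f (w ^ k) = 1
    rw [map_pow, hfw, ← ofAdd_nsmul]
    simp
  intro h
  have := hle ((QuotientGroup.eq_one_iff w).1 h)
  rw [MonoidHom.mem_ker, hfw, ofAdd_eq_one] at this
  have : Fact (1 < k) := ⟨hk⟩
  exact one_ne_zero ‹(1 : ZMod k) = 0›

/-- Asphericity consequence: every finite subgroup of `G̃` is conjugate either to a subgroup of
`ι̃(G)` or to a subgroup of the cyclic group `⟨q(w)⟩`. -/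
theorem finite_subgroups {G : Type*} [Group G] (w : FP G) (hw : Unimodular w)
    (k : ℕ) (hk : 2 ≤ k) :
    ∀ H : Subgroup (FP G ⧸ Subgroup.normalClosure {w ^ k}),
      (H : Set (FP G ⧸ Subgroup.normalClosure {w ^ k})).Finite →
      ∃ x : FP G ⧸ Subgroup.normalClosure {w ^ k},
        (∀ h ∈ H, x * h * x⁻¹ ∈
            ((QuotientGroup.mk' (Subgroup.normalClosure {w ^ k})).comp (emb G)).range) ∨
        (∀ h ∈ H, x * h * x⁻¹ ∈
            Subgroup.zpowers ((QuotientGroup.mk' (Subgroup.normalClosure {w ^ k})) w)) := by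
  intro H hH
  have hwk := hw.mk_ne_one hk
  set q := QuotientGroup.mk' (Subgroup.normalClosure {w ^ k})
  obtain ⟨m, y, p, x, hx, hy⟩ := hw.exists_conj_eq_ev_mul_castSucc
  let s : Subgroup.zpowers (q (x * w * x⁻¹)) := ⟨_, Subgroup.mem_zpowers _⟩
  have hs : s ≠ 1 := by
    intro h
    have : q (x * w * x⁻¹) = 1 := congrArg Subtype.val h
    rw [map_mul, map_mul, map_inv, conj_eq_one_iff] at this
    exact hwk this
  have hsk : s ^ k = 1 := by
    refine Subtype.ext ?_
    change q (x * w * x⁻¹) ^ k = 1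
    rw [← map_pow, conj_pow, map_mul, map_mul, map_inv, conj_eq_one_iff]
    exact (QuotientGroup.eq_one_iff _).2 (Subgroup.subset_normalClosure rfl)
  have hker : q.ker ≤ (Splitting.ofFP y p s).ker := by
    refine (QuotientGroup.ker_mk' _).trans_le ?_
    refine Subgroup.normalClosure_le_normal (Set.singleton_subset_iff.2 ?_)
    have h := congrArg (· ^ k) (Splitting.ofFP_ev_mul_tgen y p s)
    simp only [← map_pow, hsk, map_one] at h
    let f := Splitting.ofFP y p s
    change f _ = 1 at h
    rwa [← hx, conj_pow, map_mul f, map_mul f, map_inv f, conj_eq_one_iff] at h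
  obtain ⟨z, hz | hz⟩ := Splitting.exists_conj_of_finite_quotient q
    (Subgroup.zpowers (q (x * w * x⁻¹))).subtype (congrArg q hx) hy hs
    (QuotientGroup.mk'_surjective _) hker H hH
  · exact ⟨z, .inl hz⟩
  · refine ⟨(q x)⁻¹ * z, .inr fun h hh => ?_⟩
    obtain ⟨⟨_, n, rfl⟩, ha⟩ := hz h hh
    refine ⟨n, ?_⟩
    have ha' : q (x * w * x⁻¹) ^ n = z * h * z⁻¹ := ha
    rw [map_mul, map_mul, map_inv, conj_zpow] at ha'
    calc q w ^ n = (q x)⁻¹ * (q x * q w ^ n * (q x)⁻¹) * q x := by group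
      _ = _ := by rw [ha']; group
end

section
/- Suppose that G is nontrivial, w ∈ F is unimodular, and either k ≥ 3, or k ≥ 2 and G contains no element of order 2. Then G̃ is not virtually cyclic: there is no subgroup of G̃ of finite index that is cyclic. -/
universe u

open Monoid Monoid.CoprodI

namespace Monoid.CoprodI

variable {ι : Type*} {M : ι → Type*} [∀ i, Group (M i)]

theorem Word.prod_injective : Function.Injective (Word.prod : Word M → CoprodI M) := by
  classical exact Word.equiv.symm.injective

theorem NeWord.prod_ne_one {i j : ι} (w : NeWord M i j) : w.prod ≠ 1 := fun h =>
  w.toList_ne_nil <| congrArg Word.toList <|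
    Word.prod_injective (h.trans Word.prod_empty.symm : w.toWord.prod = Word.empty.prod)

theorem NeWord.toList_eq_of_prod_eq {i j i' j' : ι} {w : NeWord M i j} {w' : NeWord M i' j'}
    (h : w.prod = w'.prod) : w.toList = w'.toList :=
  congrArg Word.toList (Word.prod_injective (h : w.toWord.prod = w'.toWord.prod))

theorem exists_neWord_prod_eq {x : CoprodI M} (hx : x ≠ 1) :
    ∃ (i j : ι) (w : NeWord M i j), w.prod = x := by
  classical
  obtain ⟨i, j, w, hw⟩ := NeWord.of_word (Word.equiv x) fun h => hx <| by
    rw [← Word.equiv.symm_apply_apply x, h]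
    exact Word.prod_empty
  refine ⟨i, j, w, ?_⟩
  rw [NeWord.prod, hw]
  exact Word.equiv.symm_apply_apply x

theorem NeWord.exists_prod_eq_pow_succ {i j : ι} (w : NeWord M i j) (hne : j ≠ i) (n : ℕ) :
    ∃ w' : NeWord M i j, w'.prod = w.prod ^ (n + 1) ∧ w.toList <+: w'.toList := by
  induction n with
  | zero => exact ⟨w, by simp, List.prefix_rfl⟩
  | succ n ih =>
    obtain ⟨w', h, -⟩ := ih
    exact ⟨.append w hne w', by rw [append_prod, h, pow_succ' _ (n + 1)], List.prefix_append _ _⟩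

/-- Two distinct cyclically reduced words of equal length, whose first letters have the same index,
have no commuting positive powers. -/
theorem NeWord.pow_mul_pow_ne {i j j' : ι} (u : NeWord M i j) (v : NeWord M i j') (hu : j ≠ i)
    (hv : j' ≠ i) (hlen : u.toList.length = v.toList.length) (hne : u.toList ≠ v.toList)
    {m n : ℕ} (hm : 0 < m) (hn : 0 < n) :
    u.prod ^ m * v.prod ^ n ≠ v.prod ^ n * u.prod ^ m := by
  obtain ⟨m, rfl⟩ := Nat.exists_eq_succ_of_ne_zero hm.ne'
  obtain ⟨n, rfl⟩ := Nat.exists_eq_succ_of_ne_zero hn.ne'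
  obtain ⟨u', hu', hpu⟩ := u.exists_prod_eq_pow_succ hu m
  obtain ⟨v', hv', hpv⟩ := v.exists_prod_eq_pow_succ hv n
  intro h
  have key : (NeWord.append u' hu v').toList = (NeWord.append v' hv u').toList :=
    toList_eq_of_prod_eq (by simpa only [append_prod, hu', hv'] using h)
  have h₁ : u.toList <+: (NeWord.append u' hu v').toList := hpu.trans (List.prefix_append _ _)
  have h₂ : v.toList <+: (NeWord.append v' hv u').toList := hpv.trans (List.prefix_append _ _)
  rw [key] at h₁
  exact hne ((List.prefix_of_prefix_length_le h₁ h₂ hlen.le).eq_of_length hlen)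

/-- A homomorphism between free products is injective if it sends the nontrivial elements of each
free factor `b` to nonempty reduced words whose end letters have colour `b`, for some colouring `c`
of the indices. -/
theorem injective_of_forall_exists_neWord {κ : Type*} {N : κ → Type*} [∀ b, Group (N b)]
    (φ : CoprodI N →* CoprodI M) (c : ι → κ)
    (H : ∀ (b : κ) (x : N b), x ≠ 1 → ∃ (i j : ι) (w : NeWord M i j),
      c i = b ∧ c j = b ∧ w.prod = φ (of x)) :
    Function.Injective φ := by
  have key : ∀ {b d : κ} (v : NeWord N b d), ∃ (i j : ι) (w : NeWord M i j),
      c i = b ∧ c j = d ∧ w.prod = φ v.prod := by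
    intro b d v
    induction v with
    | singleton x hx => simpa using H _ x hx
    | append v₁ hne v₂ ih₁ ih₂ =>
      obtain ⟨i₁, j₁, w₁, hi₁, hj₁, h₁⟩ := ih₁
      obtain ⟨i₂, j₂, w₂, hi₂, hj₂, h₂⟩ := ih₂
      refine ⟨i₁, j₂, .append w₁ (fun h => hne ?_) w₂, hi₁, hj₂, ?_⟩
      · rw [← hj₁, ← hi₂, h]
      · simp [h₁, h₂]
  rw [injective_iff_map_eq_one]
  intro x hx
  by_contra hx1
  obtain ⟨b, d, v, rfl⟩ := exists_neWord_prod_eq hx1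
  obtain ⟨i, j, w, -, -, hw⟩ := key v
  exact w.prod_ne_one (hw.trans hx)

end Monoid.CoprodI

namespace Monoid.CoprodI

variable {G : Type*} [Group G] {κ ι : Type*}

/-- The homomorphism between free powers of `G` induced by a map of index sets. -/
def reindex (e : κ → ι) : CoprodI (fun _ : κ => G) →* CoprodI (fun _ : ι => G) :=
  lift fun i => of (M := fun _ : ι => G) (i := e i)

@[simp]
theorem reindex_of (e : κ → ι) (i : κ) (g : G) :
    reindex e (of (M := fun _ : κ => G) (i := i) g) = of (M := fun _ : ι => G) (i := e i) g :=
  lift_of _ _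

theorem exists_neWord_prod_eq_reindex {e : κ → ι} (he : Function.Injective e)
    {x : CoprodI (fun _ : κ => G)} (hx : x ≠ 1) :
    ∃ (i j : κ) (w : NeWord (fun _ : ι => G) (e i) (e j)), w.prod = reindex e x := by
  obtain ⟨i, j, v, rfl⟩ := exists_neWord_prod_eq hx
  refine ⟨i, j, ?_⟩
  clear hx
  induction v with
  | singleton x hx => exact ⟨.singleton x hx, by simp⟩
  | append v₁ hne v₂ ih₁ ih₂ =>
    obtain ⟨w₁, h₁⟩ := ih₁
    obtain ⟨w₂, h₂⟩ := ih₂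
    exact ⟨.append w₁ (he.ne hne) w₂, by simp [h₁, h₂]⟩

/-- If `h` lies in no product `range (reindex a) * range (reindex b)`, some element of its double
coset has a reduced form that starts outside `range a` and ends outside `range b`. -/
theorem exists_neWord_double_coset {κ' : Type*} (a : κ → ι) (b : κ' → ι)
    (h : CoprodI (fun _ : ι => G)) (hh : ∀ p q, h ≠ reindex a p * reindex b q) :
    ∃ p q, ∃ (i j : ι) (w : NeWord (fun _ : ι => G) i j),
      i ∉ Set.range a ∧ j ∉ Set.range b ∧ w.prod = reindex a p * h * reindex b q := by
  classical
  let S : Set (Word fun _ : ι => G) := {W | ∃ p q, W.prod = reindex a p * h * reindex b q}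
  have hS : S.Nonempty := ⟨Word.equiv h, 1, 1, by
    rw [map_one, map_one, one_mul, mul_one]
    exact Word.equiv.symm_apply_apply h⟩
  obtain ⟨W, ⟨p, q, hW⟩, hmin⟩ :=
    WellFounded.has_min (measure fun W : Word fun _ : ι => G => W.toList.length).wf S hS
  have hmin' : ∀ W' ∈ S, W.toList.length ≤ W'.toList.length := fun W' h' => not_lt.1 (hmin W' h')
  obtain ⟨i, j, w, hw⟩ := NeWord.of_word W fun h0 => hh p⁻¹ q⁻¹ <| by
    rw [h0, Word.prod_empty] at hW
    rw [map_inv, map_inv, eq_mul_inv_iff_mul_eq, ← mul_eq_one_iff_eq_inv', ← mul_assoc, ← hW]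
  have hwW : w.toList = W.toList := congrArg Word.toList hw
  refine ⟨p, q, i, j, w, ?_, ?_, by rw [← hW, ← hw]; rfl⟩
  · rintro ⟨r, rfl⟩
    have hd := w.toList_head?
    rw [hwW, List.head?_eq_some_iff] at hd
    obtain ⟨l, hl⟩ := hd
    have hc := W.chain_ne
    rw [hl] at hc
    have := hmin' ⟨l, fun x hx => W.ne_one x (by simp [hl, hx]), hc.tail⟩
      ⟨of (M := fun _ : κ => G) (i := r) w.head⁻¹ * p, q, by
        rw [map_mul, mul_assoc, mul_assoc, ← mul_assoc _ h, ← hW]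
        simp [Word.prod, hl]⟩
    simp [hl] at this
  · rintro ⟨r, rfl⟩
    have hd := w.toList_getLast?
    rw [hwW, List.getLast?_eq_some_iff] at hd
    obtain ⟨l, hl⟩ := hd
    have hc := W.chain_ne
    rw [hl] at hc
    have := hmin' ⟨l, fun x hx => W.ne_one x (by simp [hl, hx]), hc.left_of_append⟩
      ⟨p, q * of (M := fun _ : κ' => G) (i := r) w.last⁻¹, by
        rw [map_mul, ← mul_assoc, ← hW]
        simp [Word.prod, hl]⟩
    simp [hl] at this

/-- If `h` is outside the product of the subgroups generated by the copies of `G` with indices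
`0, …, s - 1` and `1, …, s`, then the first of these and the conjugate of the second by `h` generate
their free product. -/
theorem injective_lift_reindex_conj (s : ℕ) (h : CoprodI (fun _ : ℕ => G))
    (hh : ∀ p q : CoprodI (fun _ : Fin s => G),
      h ≠ reindex (fun i : Fin s => (i : ℕ)) p * reindex (fun i : Fin s => (i : ℕ) + 1) q) :
    Function.Injective (lift (M := fun _ : Bool => CoprodI (fun _ : Fin s => G)) fun c =>
      cond c (reindex fun i : Fin s => (i : ℕ))
        ((MulAut.conj h).toMonoidHom.comp (reindex fun i : Fin s => (i : ℕ) + 1))) := by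
  classical
  have hα : Function.Injective fun i : Fin s => (i : ℕ) := Fin.val_injective
  have hβ : Function.Injective fun i : Fin s => (i : ℕ) + 1 :=
    (add_left_injective 1).comp Fin.val_injective
  obtain ⟨p, q, i, j, w, hi, hj, hw⟩ := exists_neWord_double_coset _ _ h hh
  have hi' : s ≤ i := not_lt.1 fun hlt => hi ⟨⟨i, hlt⟩, rfl⟩
  set φ := lift (M := fun _ : Bool => CoprodI (fun _ : Fin s => G)) fun c =>
      cond c (reindex fun i : Fin s => (i : ℕ))
        ((MulAut.conj h).toMonoidHom.comp (reindex fun i : Fin s => (i : ℕ) + 1)) with hφ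
  set P := reindex (fun i : Fin s => (i : ℕ)) p
  set Q := reindex (fun i : Fin s => (i : ℕ) + 1) q
  suffices H : Function.Injective ((MulAut.conj P).toMonoidHom.comp φ) from
    Function.Injective.of_comp (f := MulAut.conj P) H
  refine injective_of_forall_exists_neWord _ (fun n : ℕ => decide (n < s)) ?_
  rintro (_ | _) x hx
  · have hx' : q⁻¹ * x * q ≠ 1 := fun h1 =>
      hx (conj_eq_one_iff (a := q⁻¹).1 (by rwa [inv_inv]))
    obtain ⟨a, b, v, hv⟩ := exists_neWord_prod_eq_reindex hβ hx'
    refine ⟨i, i, .append (.append w (fun h' => hj ⟨a, h'.symm⟩) v) (fun h' => hj ⟨b, h'⟩) w.inv,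
      by simpa, by simpa, ?_⟩
    simp [hφ, hv, hw, Q, P, mul_assoc]
  · have hx' : p * x * p⁻¹ ≠ 1 := fun h1 => hx (conj_eq_one_iff.1 h1)
    obtain ⟨a, b, v, hv⟩ := exists_neWord_prod_eq_reindex hα hx'
    exact ⟨_, _, v, by simp, by simp, by simp [hφ, hv, P]⟩

end Monoid.CoprodI

/-- Amalgamated free products of two groups along injective homomorphisms exist. -/
theorem exists_amalgam {W A B : Type u} [Group W] [Group A] [Group B] (φ : W →* A) (ψ : W →* B)
    (hφ : Function.Injective φ) (hψ : Function.Injective ψ) :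
    ∃ (L : Type u) (_ : Group L) (a : A →* L) (b : B →* L),
      Function.Injective b ∧ a.comp φ = b.comp ψ := by
  let V : Bool → Type u := fun c => cond c A B
  let (c : Bool) : Group (V c) := match c with
    | true => ‹Group A›
    | false => ‹Group B›
  let θ : ∀ c, W →* V c := fun c => match c with
    | true => φ
    | false => ψ
  have hθ : ∀ c, Function.Injective (θ c) := fun c => match c with
    | true => hφ
    | false => hψ
  exact ⟨PushoutI θ, inferInstance, PushoutI.of (φ := θ) true, PushoutI.of (φ := θ) false,
    PushoutI.of_injective hθ false,
    (PushoutI.of_comp_eq_base (φ := θ) true).trans (PushoutI.of_comp_eq_base (φ := θ) false).symm⟩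

/-- The free power of `P` over `ZMod k` embeds in a group containing an element of order dividing
`k` that permutes the free factors cyclically. -/
theorem exists_cyclic_extension (P : Type u) [Group P] (k : ℕ) :
    ∃ (B : Type u) (_ : Group B) (ε : CoprodI (fun _ : ZMod k => P) →* B) (y : B),
      Function.Injective ε ∧ y ^ k = 1 ∧
        ∀ i p, y * ε (of (M := fun _ : ZMod k => P) (i := i) p) * y⁻¹ =
          ε (of (M := fun _ : ZMod k => P) (i := i + 1) p) := by
  have hadd : ∀ m n : ZMod k, (reindex (G := P) fun i => m + i).comp (reindex fun i => n + i) =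
      reindex fun i => (m + n) + i := fun m n => by
    ext i p
    simp [add_assoc]
  have hzero : (reindex (G := P) fun i : ZMod k => 0 + i) = MonoidHom.id _ := by
    ext i p
    simp
  let σ : Multiplicative (ZMod k) →* MulAut (CoprodI fun _ : ZMod k => P) :=
    MonoidHom.mk' (fun n => MonoidHom.toMulEquiv (reindex fun i => n.toAdd + i)
      (reindex fun i => -n.toAdd + i) (by rw [hadd, neg_add_cancel, hzero])
      (by rw [hadd, add_neg_cancel, hzero])) fun m n => by
        ext x
        exact (DFunLike.congr_fun (hadd m.toAdd n.toAdd) x).symm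
  refine ⟨_ ⋊[σ] _, inferInstance, SemidirectProduct.inl,
    SemidirectProduct.inr (Multiplicative.ofAdd 1), SemidirectProduct.inl_injective, ?_, ?_⟩
  · rw [← map_pow, ← ofAdd_nsmul]
    simp
  · intro i p
    rw [← map_inv, ← SemidirectProduct.inl_aut]
    exact congrArg _ ((reindex_of _ _ _).trans (by rw [add_comm]))

/-- In a group with a cyclic subgroup of finite index, any two elements have commuting
positive powers. -/
theorem exists_pow_commute_of_isCyclic {Q : Type*} [Group Q] {H : Subgroup Q} (hH : H.index ≠ 0)
    [IsCyclic H] (a b : Q) : ∃ m n : ℕ, 0 < m ∧ 0 < n ∧ Commute (a ^ m) (b ^ n) := by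
  obtain ⟨m, hm, -, ha⟩ := Subgroup.exists_pow_mem_of_index_ne_zero hH a
  obtain ⟨n, hn, -, hb⟩ := Subgroup.exists_pow_mem_of_index_ne_zero hH b
  let := IsCyclic.commGroup (α := H)
  exact ⟨m, n, hm, hn, congrArg Subtype.val (mul_comm (⟨_, ha⟩ : H) ⟨_, hb⟩)⟩

/-- A free power of `G` over `ZMod k` contains two elements without commuting positive powers. -/
theorem exists_forall_pow_not_commute {G : Type*} [Group G] [Nontrivial G] {k : ℕ}
    (hk : 3 ≤ k ∨ (2 ≤ k ∧ ∀ g : G, orderOf g ≠ 2)) :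
    ∃ u v : CoprodI (fun _ : ZMod k => G), ∀ m n : ℕ, 0 < m → 0 < n →
      ¬ Commute (u ^ m) (v ^ n) := by
  obtain ⟨g, hg⟩ := exists_ne (1 : G)
  have hk2 : 2 ≤ k := hk.elim (by omega) And.left
  have h01 : (0 : ZMod k) ≠ 1 := by
    have : Fact (1 < k) := ⟨hk2⟩
    exact zero_ne_one
  suffices H : ∃ (j : ZMod k) (b : G), 0 ≠ j ∧ b ≠ 1 ∧
      (⟨1, g⟩ : Σ _ : ZMod k, G) ≠ ⟨j, b⟩ by
    obtain ⟨j, b, hj, hb, hne⟩ := H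
    let u := NeWord.append (.singleton g hg) h01 (.singleton (M := fun _ : ZMod k => G) g hg)
    let v := NeWord.append (.singleton g hg) hj (.singleton (M := fun _ : ZMod k => G) b hb)
    refine ⟨u.prod, v.prod, fun m n hm hn => u.pow_mul_pow_ne v h01.symm hj.symm rfl ?_ hm hn⟩
    simpa [u, v, NeWord.toList] using hne
  obtain hk | ⟨-, h2⟩ := hk
  · refine ⟨2, g, ?_, hg, fun h => ?_⟩
    · intro h
      have h := (ZMod.natCast_eq_natCast_iff 0 2 k).1 (by exact_mod_cast h)
      rw [Nat.ModEq, Nat.mod_eq_of_lt, Nat.mod_eq_of_lt] at h <;> omega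
    · have h := (ZMod.natCast_eq_natCast_iff 1 2 k).1 (by exact_mod_cast (Sigma.mk.inj h).1)
      rw [Nat.ModEq, Nat.mod_eq_of_lt, Nat.mod_eq_of_lt] at h <;> omega
  · refine ⟨1, g⁻¹, h01, inv_ne_one.2 hg, fun h => h2 g ?_⟩
    have h : g = g⁻¹ := by simpa using h
    exact orderOf_eq_prime (by rw [pow_two, mul_eq_one_iff_eq_inv.2 h]) hg

/-- If `F` maps to a group in such a way that `w ^ k` dies and `G` has `k` conjugates by powers of
some `y` which generate their free product, then `G̃` is not virtually cyclic. -/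
theorem not_virtually_cyclic_of_hom {G : Type*} [Group G] [Nontrivial G] {w : FP G} {k : ℕ}
    (hk : 3 ≤ k ∨ (2 ≤ k ∧ ∀ g : G, orderOf g ≠ 2)) {L : Type*} [Group L] (f : FP G →* L)
    (e : CoprodI (fun _ : ZMod k => G) →* L) (he : Function.Injective e) {c : FP G}
    (hc : f (c * w * c⁻¹) ^ k = 1)
    (h0 : ∀ g, e (of (M := fun _ : ZMod k => G) (i := 0) g) = f (emb G g))
    (hy : ∀ i g, f (c * w * c⁻¹) * e (of (M := fun _ : ZMod k => G) (i := i) g) *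
      (f (c * w * c⁻¹))⁻¹ = e (of (M := fun _ : ZMod k => G) (i := i + 1) g)) :
    ¬ ∃ H : Subgroup (FP G ⧸ Subgroup.normalClosure {w ^ k}), H.index ≠ 0 ∧ IsCyclic H := by
  rintro ⟨H, hH, _⟩
  have : NeZero k := ⟨by have := hk.elim (by omega) And.left; omega⟩
  have hrange : ∀ x, e x ∈ f.range := by
    have hnat : ∀ (i : ℕ) (g : G),
        e (of (M := fun _ : ZMod k => G) (i := (i : ZMod k)) g) ∈ f.range := by
      intro i g
      induction i with
      | zero => exact ⟨emb G g, by rw [← h0, Nat.cast_zero]⟩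
      | succ i ih =>
        rw [Nat.cast_succ, ← hy]
        exact mul_mem (mul_mem ⟨_, rfl⟩ ih) (inv_mem ⟨_, rfl⟩)
    intro x
    induction x using CoprodI.induction_on with
    | one => simp
    | of i g => simpa using hnat i.val g
    | mul x y hx hy => rw [map_mul]; exact mul_mem hx hy
  have hw : Subgroup.normalClosure {w ^ k} ≤ f.ker := by
    refine Subgroup.normalClosure_le_normal (Set.singleton_subset_iff.2 ?_)
    rw [SetLike.mem_coe, MonoidHom.mem_ker, map_pow]
    simpa [conj_pow] using hc
  obtain ⟨u, v, huv⟩ := exists_forall_pow_not_commute hk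
  obtain ⟨a, ha⟩ := hrange u
  obtain ⟨b, hb⟩ := hrange v
  obtain ⟨m, n, hm, hn, hab⟩ := exists_pow_commute_of_isCyclic hH
    (QuotientGroup.mk' _ a) (QuotientGroup.mk' _ b)
  refine huv m n hm hn (Commute.of_map he ?_)
  simpa [ha, hb] using hab.map (QuotientGroup.lift _ f hw)

section Levels

variable {G : Type*} [Group G]

/-- The homomorphism sending the copy of `G` with index `i` to its conjugate by `t ^ i`. -/
def levels (G : Type*) [Group G] : CoprodI (fun _ : ℕ => G) →* FP G :=
  lift fun i => (MulAut.conj (tgen G ^ i)).toMonoidHom.comp (emb G)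

@[simp]
theorem levels_of (i : ℕ) (g : G) :
    levels G (of (M := fun _ : ℕ => G) (i := i) g) = tgen G ^ i * emb G g * (tgen G ^ i)⁻¹ := by
  rw [levels, lift_of]
  rfl

theorem expSum_tgen : expSum G (tgen G) = Multiplicative.ofAdd 1 := by
  simp [expSum, tgen]

theorem expSum_emb (g : G) : expSum G (emb G g) = 1 := by
  simp [expSum, emb]

theorem levels_reindex_succ {κ : Type*} (e : κ → ℕ) (p : CoprodI fun _ : κ => G) :
    levels G (reindex (fun i => e i + 1) p) = tgen G * levels G (reindex e p) * (tgen G)⁻¹ := by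
  have : (levels G).comp (reindex fun i => e i + 1) =
      (MulAut.conj (tgen G)).toMonoidHom.comp ((levels G).comp (reindex e)) := by
    ext i g
    simp [pow_succ', mul_assoc]
  exact DFunLike.congr_fun this p

theorem reindex_reindex_castLE {s s' : ℕ} (h : s ≤ s') (p : CoprodI fun _ : Fin s => G) :
    reindex (fun i : Fin s' => (i : ℕ)) (reindex (Fin.castLE h) p) =
      reindex (fun i : Fin s => (i : ℕ)) p := by
  have : (reindex fun i : Fin s' => (i : ℕ)).comp (reindex (G := G) (Fin.castLE h)) =
      reindex fun i : Fin s => (i : ℕ) := by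
    ext i g
    simp
  exact DFunLike.congr_fun this p

theorem exists_reindex_fin_eq (x : CoprodI fun _ : ℕ => G) :
    ∃ (s : ℕ) (p : CoprodI fun _ : Fin s => G), reindex (fun i : Fin s => (i : ℕ)) p = x := by
  induction x using CoprodI.induction_on with
  | one => exact ⟨0, 1, map_one _⟩
  | of i g => exact ⟨i + 1, of (M := fun _ : Fin (i + 1) => G) (i := Fin.last i) g, by simp⟩
  | mul x y hx hy =>
    obtain ⟨s, p, rfl⟩ := hx
    obtain ⟨s', p', rfl⟩ := hy
    exact ⟨max s s', reindex (Fin.castLE (le_max_left _ _)) p *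
      reindex (Fin.castLE (le_max_right _ _)) p', by
      rw [map_mul, reindex_reindex_castLE, reindex_reindex_castLE]⟩

/-- Conjugation by a high power of `t` turns every element into `t ^ σ` times a product of
conjugates of `G` by nonnegative powers of `t`. -/
theorem exists_forall_conj_mem_range_levels (f : FP G) :
    ∃ R : ℤ, ∀ n ≥ R, tgen G ^ n * f * tgen G ^ (-((expSum G f).toAdd + n)) ∈ (levels G).range := by
  set T := tgen G
  have hmul : ∀ f₁ f₂ : FP G,
      (∃ R : ℤ, ∀ n ≥ R, T ^ n * f₁ * T ^ (-((expSum G f₁).toAdd + n)) ∈ (levels G).range) →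
      (∃ R : ℤ, ∀ n ≥ R, T ^ n * f₂ * T ^ (-((expSum G f₂).toAdd + n)) ∈ (levels G).range) →
      ∃ R : ℤ, ∀ n ≥ R, T ^ n * (f₁ * f₂) * T ^ (-((expSum G (f₁ * f₂)).toAdd + n)) ∈
        (levels G).range := by
    rintro f₁ f₂ ⟨R₁, h₁⟩ ⟨R₂, h₂⟩
    refine ⟨max R₁ (R₂ - (expSum G f₁).toAdd), fun n hn => ?_⟩
    rw [ge_iff_le, max_le_iff] at hn
    convert mul_mem (h₁ n hn.1) (h₂ ((expSum G f₁).toAdd + n) (by linarith)) using 1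
    rw [map_mul, toAdd_mul]
    have : T ^ (-((expSum G f₁).toAdd + n)) * T ^ ((expSum G f₁).toAdd + n) = 1 := by
      rw [← zpow_add]; simp
    rw [mul_assoc (T ^ n * f₁), ← mul_assoc (T ^ (-_)), ← mul_assoc (T ^ (-_)), this, one_mul]
    simp only [mul_assoc]
    congr 5
    ring
  have hpow : ∀ m : ℤ, ∃ R : ℤ, ∀ n ≥ R,
      T ^ n * T ^ m * T ^ (-((expSum G (T ^ m)).toAdd + n)) ∈ (levels G).range := fun m => by
    refine ⟨0, fun n _ => ?_⟩
    rw [map_zpow, expSum_tgen, ← zpow_add, ← zpow_add, toAdd_zpow, toAdd_ofAdd, smul_eq_mul,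
      mul_one, add_comm n, add_neg_cancel, zpow_zero]
    exact one_mem _
  induction f using Coprod.induction_on with
  | inl g =>
    refine ⟨0, fun n hn => ?_⟩
    lift n to ℕ using hn
    refine ⟨of (M := fun _ : ℕ => G) (i := n) g, ?_⟩
    rw [levels_of]
    change _ = T ^ (n : ℤ) * emb G g * T ^ (-((expSum G (emb G g)).toAdd + n))
    simp [expSum_emb, T]
  | inr x =>
    induction x using FreeGroup.induction_on with
    | C1 => simp
    | of x => simpa [T, tgen] using hpow 1
    | inv_of x _ => simpa [T, tgen] using hpow (-1)
    | mul x y hx hy => rw [map_mul]; exact hmul _ _ hx hy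
  | mul f₁ f₂ h₁ h₂ => exact hmul _ _ h₁ h₂

/-- `w` is conjugate to the product of `t` and a word in the conjugates of `G` by
`1, t, …, t ^ (s - 1)`. -/
def IsConjToLevels (w : FP G) (s : ℕ) : Prop :=
  ∃ (c : FP G) (p : CoprodI fun _ : Fin s => G),
    c * w * c⁻¹ = levels G (reindex (fun i : Fin s => (i : ℕ)) p) * tgen G

theorem IsConjToLevels.mono {w : FP G} {s s' : ℕ} (h : IsConjToLevels w s) (hs : s ≤ s') :
    IsConjToLevels w s' := by
  obtain ⟨c, p, hc⟩ := h
  exact ⟨c, reindex (Fin.castLE hs) p, by rw [hc, reindex_reindex_castLE]⟩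

theorem Unimodular.exists_isConjToLevels {w : FP G} (hw : Unimodular w) :
    ∃ s, IsConjToLevels w s := by
  obtain ⟨R, hR⟩ := exists_forall_conj_mem_range_levels w
  obtain ⟨x, hx⟩ := hR R le_rfl
  obtain ⟨s, p, rfl⟩ := exists_reindex_fin_eq x
  refine ⟨s, tgen G ^ R, p, ?_⟩
  rw [hx, hw, ← zpow_neg, mul_assoc _ _ (tgen G), ← zpow_add_one]
  simp

theorem IsConjToLevels.of_eq_mul {w c : FP G} {s : ℕ} {h : CoprodI fun _ : ℕ => G}
    (hc : c * w * c⁻¹ = levels G h * tgen G) {p q : CoprodI fun _ : Fin s => G}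
    (hpq : h = reindex (fun i : Fin s => (i : ℕ)) p * reindex (fun i : Fin s => (i : ℕ) + 1) q) :
    IsConjToLevels w s := by
  refine ⟨levels G (reindex (fun i : Fin s => (i : ℕ)) q) * c, q * p, ?_⟩
  rw [hpq, map_mul, levels_reindex_succ] at hc
  set Q := levels G (reindex (fun i : Fin s => (i : ℕ)) q) with hQ
  calc Q * c * w * (Q * c)⁻¹ = Q * (c * w * c⁻¹) * Q⁻¹ := by group
    _ = _ := by
      rw [hc, map_mul, map_mul, ← hQ]
      group

end Levels

/-- If `w` is conjugate to `g * t` with `g` in `G`, then `G̃` is not virtually cyclic. -/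
theorem not_virtually_cyclic_of_isConjToLevels_one {G : Type u} [Group G] [Nontrivial G]
    {w : FP G} {k : ℕ} (hk : 3 ≤ k ∨ (2 ≤ k ∧ ∀ g : G, orderOf g ≠ 2))
    (hw : IsConjToLevels w 1) :
    ¬ ∃ H : Subgroup (FP G ⧸ Subgroup.normalClosure {w ^ k}), H.index ≠ 0 ∧ IsCyclic H := by
  obtain ⟨c, p, hc⟩ := hw
  obtain ⟨B, _, ε, y, hε, hyk, hy⟩ := exists_cyclic_extension G k
  obtain ⟨g, hg⟩ : ∃ g, levels G (reindex (fun i : Fin 1 => (i : ℕ)) p) = emb G g := by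
    have : (levels G).comp (reindex fun i : Fin 1 => (i : ℕ)) =
        (emb G).comp (lift fun _ => MonoidHom.id G) := by
      ext i x
      simp
    exact ⟨_, DFunLike.congr_fun this p⟩
  let ε₀ : G →* B := ε.comp (of (M := fun _ : ZMod k => G) (i := 0))
  let f : FP G →* B := Coprod.lift ε₀ (FreeGroup.lift fun _ => (ε₀ g)⁻¹ * y)
  have hf : ∀ x, f (emb G x) = ε₀ x := fun x => Coprod.lift_apply_inl _ _ _
  have hcy : f (c * w * c⁻¹) = y := by
    rw [hc, hg, map_mul, hf]
    simp [f, tgen]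
  exact not_virtually_cyclic_of_hom hk f ε hε (by rw [hcy, hyk]) (fun x => (hf x).symm)
    (by rwa [hcy])

/-- If `s` is positive and minimal such that `w` is conjugate to the product of `t` and a word in
the first `s + 1` conjugates of `G`, then `G̃` is not virtually cyclic. -/
theorem not_virtually_cyclic_of_isConjToLevels_succ {G : Type u} [Group G] [Nontrivial G]
    {w : FP G} {k : ℕ} (hk : 3 ≤ k ∨ (2 ≤ k ∧ ∀ g : G, orderOf g ≠ 2)) {s : ℕ} (hs : 0 < s)
    (hw : IsConjToLevels w (s + 1)) (hmin : ¬ IsConjToLevels w s) :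
    ¬ ∃ H : Subgroup (FP G ⧸ Subgroup.normalClosure {w ^ k}), H.index ≠ 0 ∧ IsCyclic H := by
  obtain ⟨c, p', hc⟩ := hw
  set h := reindex (fun i : Fin (s + 1) => (i : ℕ)) p'
  let P := CoprodI fun _ : Fin s => G
  obtain ⟨B, _, ε, y, hε, hyk, hy⟩ := exists_cyclic_extension P k
  let ψ : CoprodI (fun _ : Bool => P) →* CoprodI fun _ : ZMod k => P :=
    reindex fun c => cond c 0 1
  have h01 : (1 : ZMod k) ≠ 0 := by
    have : Fact (1 < k) := ⟨hk.elim (by omega) And.left⟩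
    exact one_ne_zero
  have hψ : Function.Injective ψ := by
    refine Function.LeftInverse.injective (g := reindex fun i : ZMod k => decide (i = 0)) ?_
    have : (reindex fun i : ZMod k => decide (i = 0)).comp ψ = MonoidHom.id _ := by
      ext (_ | _) x <;> simp [ψ, h01]
    exact DFunLike.congr_fun this
  obtain ⟨L, _, a, b, hb, hab⟩ := exists_amalgam _ (ε.comp ψ)
    (injective_lift_reindex_conj s h fun p q hpq => hmin (.of_eq_mul hc hpq)) (hε.comp hψ)
  have hα : ∀ p : P, a (reindex (fun i : Fin s => (i : ℕ)) p) =
      b (ε (of (M := fun _ : ZMod k => P) (i := 0) p)) := fun p => by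
    simpa [ψ] using DFunLike.congr_fun hab (of (M := fun _ : Bool => P) (i := true) p)
  have hβ : ∀ p : P, a h * a (reindex (fun i : Fin s => (i : ℕ) + 1) p) * (a h)⁻¹ =
      b (ε (of (M := fun _ : ZMod k => P) (i := 1) p)) := fun p => by
    simpa [ψ] using DFunLike.congr_fun hab (of (M := fun _ : Bool => P) (i := false) p)
  have hαβ : ∀ p : P, ((a h)⁻¹ * b y) * a (reindex (fun i : Fin s => (i : ℕ)) p) *
      ((a h)⁻¹ * b y)⁻¹ = a (reindex (fun i : Fin s => (i : ℕ) + 1) p) := fun p => by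
    have key := hy 0 p
    rw [zero_add] at key
    calc _ = (a h)⁻¹ * b (y * ε (of (M := fun _ : ZMod k => P) (i := 0) p) * y⁻¹) * a h := by
          rw [hα]
          simp [mul_assoc]
      _ = _ := by
          rw [key, ← hβ]
          group
  let f : FP G →* L := Coprod.lift (a.comp (of (M := fun _ : ℕ => G) (i := 0)))
    (FreeGroup.lift fun _ => (a h)⁻¹ * b y)
  have hf : ∀ x, f (emb G x) = a (of (M := fun _ : ℕ => G) (i := 0) x) :=
    fun x => Coprod.lift_apply_inl _ _ _
  have hft : f (tgen G) = (a h)⁻¹ * b y := by simp [f, tgen]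
  have hlevel : ∀ i ≤ s, ∀ g, f (levels G (of (M := fun _ : ℕ => G) (i := i) g)) =
      a (of (M := fun _ : ℕ => G) (i := i) g) := by
    intro i hi g
    induction i with
    | zero => simp [hf]
    | succ i ih =>
      have := hαβ (of (M := fun _ : Fin s => G) (i := ⟨i, hi⟩) g)
      rw [reindex_of, reindex_of, ← ih (by omega), ← hft] at this
      rw [← this]
      simp [pow_succ', mul_assoc]
  have hfh : f (levels G h) = a h := by
    have : (f.comp (levels G)).comp (reindex fun i : Fin (s + 1) => (i : ℕ)) =
        a.comp (reindex fun i : Fin (s + 1) => (i : ℕ)) := by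
      ext i g
      simpa using hlevel i (Nat.lt_succ_iff.1 i.2) g
    exact DFunLike.congr_fun this p'
  have hcy : f (c * w * c⁻¹) = b y := by
    rw [hc, map_mul, hfh, hft, mul_inv_cancel_left]
  let ι₀ : G →* P := of (M := fun _ : Fin s => G) (i := ⟨0, hs⟩)
  let e : CoprodI (fun _ : ZMod k => G) →* CoprodI fun _ : ZMod k => P :=
    lift fun i => (of (M := fun _ : ZMod k => P) (i := i)).comp ι₀
  have he : Function.Injective e := by
    refine Function.LeftInverse.injective
      (g := lift fun i => (of (M := fun _ : ZMod k => G) (i := i)).comp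
        (lift fun _ : Fin s => MonoidHom.id G)) ?_
    have : (lift fun i => (of (M := fun _ : ZMod k => G) (i := i)).comp
        (lift fun _ : Fin s => MonoidHom.id G)).comp e = MonoidHom.id _ := by
      ext i x
      simp only [e, MonoidHom.comp_apply, lift_of, MonoidHom.id_apply]
      exact congrArg _ (lift_of (M := fun _ : Fin s => G) (fun _ => MonoidHom.id G) x)
    exact DFunLike.congr_fun this
  refine not_virtually_cyclic_of_hom hk f ((b.comp ε).comp e) ((hb.comp hε).comp he) (c := c)
    (by rw [hcy, ← map_pow, hyk, map_one]) (fun g => ?_) fun i g => ?_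
  · rw [hf]
    simpa [e, ι₀] using ((hα (ι₀ g)).symm.trans (congrArg a (reindex_of _ _ _)))
  · rw [hcy]
    simpa [e] using congrArg b (hy i (ι₀ g))

/-- `G̃` is not virtually cyclic. -/
theorem not_virtually_cyclic {G : Type*} [Group G] (hG : Nontrivial G) (w : FP G)
    (hw : Unimodular w) (k : ℕ)
    (hk : 3 ≤ k ∨ (2 ≤ k ∧ ∀ g : G, orderOf g ≠ 2)) :
    ¬ ∃ H : Subgroup (FP G ⧸ Subgroup.normalClosure {w ^ k}),
        H.index ≠ 0 ∧ IsCyclic H := by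
  classical
  have hex := hw.exists_isConjToLevels
  by_cases h1 : Nat.find hex ≤ 1
  · exact not_virtually_cyclic_of_isConjToLevels_one hk ((Nat.find_spec hex).mono h1)
  · obtain ⟨s, hs⟩ := Nat.exists_eq_succ_of_ne_zero (n := Nat.find hex) (by omega)
    exact not_virtually_cyclic_of_isConjToLevels_succ hk (s := s) (by omega)
      ((Nat.find_spec hex).mono hs.le) (Nat.find_min hex (by omega))
end
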